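/- arXiv:math/0608755 — 3 statements merged into one kernel-verified Lean document; each statement's English description precedes it below -/
import Mathlib

section
/- Let q = 2 and let A be an integral domain containing F_2 with unit group A^× = {1}, such that deg a := dim_{F_2}(A/aA) is finite for every nonzero a ∈ A, each V_n := {a ∈ A : a = 0 or deg a ≤ n} is an F_2-subspace of A with dim_{F_2} V_n = 1 + card{m : 1 ≤ m ≤ n, m is not a gap of A}, and the number g of gaps of A is finite (g is the genus of K). Assume A is hyperelliptic in the sense that some x ∈ A has deg x = 2. Then for every positive integer s with l_2(s) ≤ g, the polynomial Z_s(X) := ∑_{d≥0} (∑_{a ∈ A∖{0}, deg a = d} a^s) X^d ∈ A[X] (all but finitely many inner sums vanish) has a zero at X = 1 of order exactly 2; i.e., the order of vanishing of ζ(−s) is 2. -/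
open Polynomial

/-- `lq q k` is the sum of the base-`q` digits of `k`. -/
def lq (q k : ℕ) : ℕ := (Nat.digits q k).sum

/-- The degree of a nonzero element `a` of a ring `A` containing a field `F`:
`deg a = dim_F (A / aA)`. -/
noncomputable def adeg (F : Type*) {A : Type*} [Field F] [CommRing A] [Algebra F A]
    (a : A) : ℕ :=
  Module.finrank F (A ⧸ Ideal.span {a})

/-- A positive integer `m` is a gap of `A` (at `∞`) if no nonzero `a ∈ A` has `deg a = m`. -/
def IsGapA (F : Type*) (A : Type*) [Field F] [CommRing A] [Algebra F A] (m : ℕ) : Prop :=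
  ¬ ∃ a : A, a ≠ 0 ∧ adeg F a = m

/-- The `d`-th coefficient `∑_{a ∈ A∖{0}, deg a = d} a^s` of the zeta polynomial of `A`. -/
noncomputable def zetaCoeff (F : Type*) {A : Type*} [Field F] [CommRing A] [Algebra F A]
    (s d : ℕ) : A :=
  ∑ᶠ a ∈ {a : A | a ≠ 0 ∧ adeg F a = d}, a ^ s

/-- The zeta polynomial `Z_s(X) = ∑_{d ≥ 0} (∑_{a ∈ A∖{0}, deg a = d} a^s) X^d ∈ A[X]`. -/
noncomputable def zetaPoly (F : Type*) (A : Type*) [Field F] [CommRing A] [Algebra F A]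
    (s : ℕ) : Polynomial A :=
  ∑ᶠ d : ℕ, C (zetaCoeff F s d) * X ^ d

/-- `f` is annihilated by every `k`-fold iterated difference operator (in characteristic two). -/
def DiffOrderLT {A : Type*} [Add A] [Zero A] : ℕ → (A → A) → Prop
  | 0, f => ∀ a, f a = 0
  | k + 1, f => ∀ w, DiffOrderLT k fun v => f v + f (v + w)

namespace DiffOrderLT

variable {A : Type*} [CommRing A]

lemma of_forall_eq {k : ℕ} {f f' : A → A} (hf : DiffOrderLT k f) (h : ∀ a, f a = f' a) :
    DiffOrderLT k f' := by
  rwa [← funext h]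

lemma zero (k : ℕ) : DiffOrderLT k fun _ : A => (0 : A) := by
  induction k with
  | zero => exact fun _ => rfl
  | succ k ih => exact fun w => ih.of_forall_eq fun _ => by simp

lemma succ {k : ℕ} {f : A → A} (hf : DiffOrderLT k f) : DiffOrderLT (k + 1) f := by
  induction k generalizing f with
  | zero => exact fun w v => by simp [hf v, hf (v + w)]
  | succ k ih => exact fun w => ih (hf w)

lemma mono {k l : ℕ} {f : A → A} (hf : DiffOrderLT k f) (hkl : k ≤ l) : DiffOrderLT l f := by
  induction l, hkl using Nat.le_induction with
  | base => exact hf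
  | succ l _ ih => exact ih.succ

lemma add {k : ℕ} {f f' : A → A} (hf : DiffOrderLT k f) (hf' : DiffOrderLT k f') :
    DiffOrderLT k fun v => f v + f' v := by
  induction k generalizing f f' with
  | zero => exact fun v => by simp [hf v, hf' v]
  | succ k ih => exact fun w => (ih (hf w) (hf' w)).of_forall_eq fun v => by ring

lemma const_mul {k : ℕ} {f : A → A} (c : A) (hf : DiffOrderLT k f) :
    DiffOrderLT k fun v => c * f v := by
  induction k generalizing f with
  | zero => exact fun v => by simp [hf v]
  | succ k ih => exact fun w => (ih (hf w)).of_forall_eq fun v => by ring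

lemma comp_add_right {k : ℕ} {f : A → A} (c : A) (hf : DiffOrderLT k f) :
    DiffOrderLT k fun v => f (v + c) := by
  induction k generalizing f with
  | zero => exact fun v => hf (v + c)
  | succ k ih => exact fun w => (ih (hf w)).of_forall_eq fun v => by rw [add_right_comm]

variable [CharP A 2]

lemma const (c : A) : DiffOrderLT 1 fun _ : A => c :=
  fun _ _ => CharTwo.add_self_eq_zero c

omit [CharP A 2] in
lemma additive_mul {k : ℕ} {f φ : A → A} (hφ : ∀ a b, φ (a + b) = φ a + φ b)
    (hf : DiffOrderLT k f) : DiffOrderLT (k + 1) fun v => φ v * f v := by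
  induction k generalizing f with
  | zero => exact ((zero 0).of_forall_eq fun v => by simp [hf v]).succ
  | succ k ih =>
    intro w
    refine ((ih (hf w)).add ((hf.comp_add_right w).const_mul (φ w))).of_forall_eq fun v => ?_
    simp only [hφ]
    ring

lemma pow_two_pow (s j : ℕ) : DiffOrderLT (lq 2 s + 1) fun a : A => a ^ (s * 2 ^ j) := by
  induction s using Nat.strong_induction_on generalizing j with
  | _ s ih =>
    rcases Nat.eq_zero_or_pos s with rfl | hs
    · simpa [lq] using const (1 : A)
    · have hlq : lq 2 s = s % 2 + lq 2 (s / 2) := by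
        simp [lq, Nat.digits_def' one_lt_two hs]
      have hpow : ∀ a : A,
          a ^ (s * 2 ^ j) = (a ^ 2 ^ j) ^ (s % 2) * a ^ (s / 2 * 2 ^ (j + 1)) := fun a => by
        rw [← pow_mul, ← pow_add]
        congr 1
        conv_lhs => rw [← Nat.mod_add_div s 2]
        ring
      have hrec := ih (s / 2) (by omega) (j + 1)
      rcases Nat.mod_two_eq_zero_or_one s with h | h
      · rw [hlq, h, zero_add]
        exact hrec.of_forall_eq fun a => by rw [hpow, h, pow_zero, one_mul]
      · rw [hlq, h, add_comm 1]
        refine (additive_mul (φ := fun a : A => a ^ 2 ^ j)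
          (fun a b => add_pow_char_pow a b 2 j) hrec).of_forall_eq fun a => ?_
        rw [hpow, h, pow_one]

lemma pow (s : ℕ) : DiffOrderLT (lq 2 s + 1) fun a : A => a ^ s := by
  simpa using pow_two_pow (A := A) s 0

omit [CharP A 2] in
lemma sum_fin_eq_zero [Algebra (ZMod 2) A] {k : ℕ} {f : A → A} (hf : DiffOrderLT k f)
    (w : Fin k → A) (v : A) : ∑ c : Fin k → ZMod 2, f (v + ∑ i, c i • w i) = 0 := by
  induction k generalizing f v with
  | zero => simpa using hf v
  | succ k ih =>
    rw [← (Fin.consEquiv fun _ => ZMod 2).sum_comp, Fintype.sum_prod_type,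
      show (Finset.univ : Finset (ZMod 2)) = {0, 1} from rfl, Finset.sum_pair (by decide),
      ← Finset.sum_add_distrib, ← ih (hf (w 0)) (fun i => w i.succ) v]
    refine Finset.sum_congr rfl fun c _ => ?_
    simp [Fin.consEquiv, Fin.sum_univ_succ, add_comm, add_left_comm]

omit [CharP A 2] in
lemma sum_submodule_eq_zero [Algebra (ZMod 2) A] {k : ℕ} {f : A → A} (hf : DiffOrderLT k f)
    (W : Submodule (ZMod 2) A) [Module.Finite (ZMod 2) W]
    (hk : k ≤ Module.finrank (ZMod 2) W) : ∑ᶠ a ∈ (W : Set A), f a = 0 := by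
  let b := Module.finBasis (ZMod 2) W
  rw [← finsum_subtype_eq_finsum_cond (· ∈ (W : Set A))]
  change ∑ᶠ a : W, f a = 0
  rw [← finsum_comp_equiv b.equivFun.symm.toEquiv, finsum_eq_sum_of_fintype]
  have := (hf.mono hk).sum_fin_eq_zero (fun i => (b i : A)) 0
  simpa [b.equivFun_symm_apply] using this

end DiffOrderLT

section Degree

variable {F A : Type*} [Field F] [CommRing A] [Algebra F A]

lemma adeg_one : adeg F (1 : A) = 0 := by
  have : Subsingleton (A ⧸ Ideal.span {(1 : A)}) :=
    Ideal.Quotient.subsingleton_iff.mpr Ideal.span_singleton_one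
  exact Module.finrank_zero_of_subsingleton

lemma isUnit_of_adeg_eq_zero {a : A} [Module.Finite F (A ⧸ Ideal.span {a})]
    (h : adeg F a = 0) : IsUnit a := by
  rw [← Ideal.span_singleton_eq_top, ← Ideal.Quotient.subsingleton_iff]
  exact Module.finrank_zero_iff.mp h

open scoped Pointwise in
lemma adeg_mul [IsDomain A] {a b : A} (hb : b ≠ 0)
    [Module.Finite F (A ⧸ Ideal.span {b * a})] :
    adeg F (b * a) = adeg F b + adeg F a := by
  have hspan : b • Ideal.span {a} = Ideal.span {b * a} := by
    rw [← Submodule.singleton_set_smul]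
    simp [← Ideal.submodule_span_eq, Submodule.set_smul_span]
  have hfin : Module.Finite F (A ⧸ b • Ideal.span {a}) := by rwa [hspan]
  let i := (Ideal.mulQuot b (Ideal.span {a})).restrictScalars F
  let p := (Ideal.quotOfMul b (Ideal.span {a})).restrictScalars F
  have hi : Function.Injective i :=
    Ideal.mulQuot_injective (Ideal.span {a}) (mem_nonZeroDivisors_of_ne_zero hb)
  have hp : Function.Surjective p := Ideal.quotOfMul_surjective (Ideal.span {a})
  have hip : Function.Exact i p := Ideal.exact_mulQuot_quotOfMul (Ideal.span {a})
  have hrank := p.finrank_range_add_finrank_ker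
  rw [LinearMap.range_eq_top.mpr hp, finrank_top, hip.linearMap_ker_eq,
    LinearMap.finrank_range_of_inj hi] at hrank
  rw [adeg, ← hspan, ← hrank]
  rfl

lemma adeg_pow [IsDomain A]
    (hfin : ∀ a : A, a ≠ 0 → Module.Finite F (A ⧸ Ideal.span {a}))
    {x : A} (hx : x ≠ 0) (n : ℕ) : adeg F (x ^ n) = n * adeg F x := by
  induction n with
  | zero => simp [adeg_one]
  | succ n ih =>
    have := hfin (x * x ^ n) (mul_ne_zero hx (pow_ne_zero n hx))
    rw [pow_succ', adeg_mul hx, ih]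
    ring

/-- If `deg x = 2`, every odd pole number exceeds twice the number of gaps. -/
lemma two_mul_ncard_gaps_lt_of_odd [IsDomain A]
    (hfin : ∀ a : A, a ≠ 0 → Module.Finite F (A ⧸ Ideal.span {a}))
    {x : A} (hx0 : x ≠ 0) (hx : adeg F x = 2) {m : ℕ} (hm : Odd m) (hgap : ¬ IsGapA F A m) :
    2 * {k : ℕ | 1 ≤ k ∧ IsGapA F A k}.ncard < m := by
  obtain ⟨y, hy0, hy⟩ := not_not.mp hgap
  obtain ⟨r, rfl⟩ := hm
  have hsub : {k : ℕ | 1 ≤ k ∧ IsGapA F A k} ⊆ (fun i => 2 * i + 1) '' (Set.Iio r) := by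
    rintro k ⟨-, hk⟩
    rcases Nat.even_or_odd' k with ⟨j, rfl | rfl⟩
    · exact absurd ⟨x ^ j, pow_ne_zero j hx0, by rw [adeg_pow hfin hx0, hx, mul_comm]⟩ hk
    · refine ⟨j, ?_, rfl⟩
      by_contra hj
      rw [Set.mem_Iio, not_lt] at hj
      refine hk ⟨x ^ (j - r) * y, mul_ne_zero (pow_ne_zero _ hx0) hy0, ?_⟩
      have := hfin (x ^ (j - r) * y) (mul_ne_zero (pow_ne_zero _ hx0) hy0)
      rw [adeg_mul (pow_ne_zero _ hx0), adeg_pow hfin hx0, hx, hy]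
      omega
  have hle := Set.ncard_le_ncard hsub ((Set.finite_Iio r).image _)
  have himg := Set.ncard_image_le (f := fun i => 2 * i + 1) (Set.finite_Iio r)
  rw [Set.ncard_Iio_nat] at himg
  omega

lemma le_ncard_nongaps [IsDomain A]
    (hfin : ∀ a : A, a ≠ 0 → Module.Finite F (A ⧸ Ideal.span {a}))
    {x : A} (hx0 : x ≠ 0) (hx : adeg F x = 2) {g n : ℕ} (hn : 2 * g ≤ n) :
    g ≤ {m : ℕ | 1 ≤ m ∧ m ≤ n ∧ ¬ IsGapA F A m}.ncard := by
  have hsub : (fun i => 2 * (i + 1)) '' (Set.Iio g) ⊆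
      {m : ℕ | 1 ≤ m ∧ m ≤ n ∧ ¬ IsGapA F A m} := by
    rintro _ ⟨i, hi, rfl⟩
    rw [Set.mem_Iio] at hi
    have h1 : 1 ≤ 2 * (i + 1) := by omega
    have hle : 2 * (i + 1) ≤ n := by omega
    exact ⟨h1, hle, not_not.mpr ⟨x ^ (i + 1), pow_ne_zero _ hx0,
      by rw [adeg_pow hfin hx0, hx, mul_comm]⟩⟩
  have hle := Set.ncard_le_ncard hsub ((Set.finite_Iic n).subset fun m hm => hm.2.1)
  rwa [Set.ncard_image_of_injective _ (fun i j h => by simpa using h),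
    Set.ncard_Iio_nat] at hle

lemma ne_zero_of_adeg_eq_two [IsDomain A] (hunit : ∀ u : Aˣ, u = 1)
    (hgfin : {m : ℕ | 1 ≤ m ∧ IsGapA F A m}.Finite) {x : A} (hx : adeg F x = 2) : x ≠ 0 := by
  rintro rfl
  have hA : Module.Finite F A := by
    have : Module.Finite F (A ⧸ Ideal.span {(0 : A)}) :=
      Module.finite_of_finrank_pos (by rw [← adeg, hx]; exact two_pos)
    rw [Ideal.span_singleton_zero] at this
    exact Module.Finite.equiv ((Submodule.quotEquivOfEqBot (⊥ : Ideal A) rfl).restrictScalars F)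
  obtain ⟨m, hm⟩ := (hgfin.insert 0).exists_notMem
  simp only [Set.mem_insert_iff, not_or, Set.mem_ofPred_eq, not_and] at hm
  obtain ⟨a, ha0, ha⟩ := not_not.mp (hm.2 (Nat.one_le_iff_ne_zero.mpr hm.1))
  obtain ⟨u, rfl⟩ := IsArtinianRing.isUnit_of_isIntegral_of_nonZeroDivisor
    (Algebra.IsIntegral.isIntegral (R := F) a) (mem_nonZeroDivisors_of_ne_zero ha0)
  rw [hunit u, Units.val_one, adeg_one] at ha
  exact hm.1 ha.symm

end Degree

section PowerSums

variable {F A : Type*} [Field F] [CommRing A] [Algebra F A]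

lemma finsum_adeg_le_succ (s n : ℕ) (hfin : {a : A | a = 0 ∨ adeg F a ≤ n + 1}.Finite) :
    ∑ᶠ a ∈ {a : A | a = 0 ∨ adeg F a ≤ n + 1}, a ^ s =
      ∑ᶠ a ∈ {a : A | a = 0 ∨ adeg F a ≤ n}, a ^ s + zetaCoeff F s (n + 1) := by
  have hunion : {a : A | a = 0 ∨ adeg F a ≤ n + 1} =
      {a : A | a = 0 ∨ adeg F a ≤ n} ∪ {a : A | a ≠ 0 ∧ adeg F a = n + 1} := by
    ext a
    simp only [Set.mem_ofPred_eq, Set.mem_union]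
    by_cases ha : a = 0
    · simp [ha]
    · simp only [ha, false_or, ne_eq, not_false_eq_true, true_and]
      omega
  have hdisj : Disjoint {a : A | a = 0 ∨ adeg F a ≤ n} {a : A | a ≠ 0 ∧ adeg F a = n + 1} := by
    refine Set.disjoint_left.mpr fun a ha hb => ?_
    rcases ha with ha | ha
    · exact hb.1 ha
    · have := hb.2
      omega
  rw [hunion] at hfin ⊢
  exact finsum_mem_union hdisj (hfin.subset Set.subset_union_left)
    (hfin.subset Set.subset_union_right)

lemma zetaCoeff_eq_zero_of_isGapA {s d : ℕ} (hd : IsGapA F A d) :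
    zetaCoeff F (A := A) s d = 0 := by
  rw [zetaCoeff, show {a : A | a ≠ 0 ∧ adeg F a = d} = ∅ from
    Set.eq_empty_of_forall_notMem fun a ha => hd ⟨a, ha⟩, finsum_mem_empty]

lemma zetaCoeff_zero (hunit : ∀ u : Aˣ, u = 1) [Nontrivial A]
    (hfin : ∀ a : A, a ≠ 0 → Module.Finite F (A ⧸ Ideal.span {a})) (s : ℕ) :
    zetaCoeff F (A := A) s 0 = 1 := by
  have : {a : A | a ≠ 0 ∧ adeg F a = 0} = {1} := by
    ext a
    refine ⟨fun ⟨ha, h⟩ => ?_, ?_⟩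
    · have := hfin a ha
      obtain ⟨u, rfl⟩ := isUnit_of_adeg_eq_zero h
      simp [hunit u]
    · rintro rfl
      exact ⟨one_ne_zero, adeg_one⟩
  rw [zetaCoeff, this, finsum_mem_singleton, one_pow]

lemma finsum_adeg_le_zero {s : ℕ} (hs : s ≠ 0)
    (hfin : {a : A | a = 0 ∨ adeg F a ≤ 0}.Finite) :
    ∑ᶠ a ∈ {a : A | a = 0 ∨ adeg F a ≤ 0}, a ^ s = zetaCoeff F s 0 := by
  have hunion : {a : A | a = 0 ∨ adeg F a ≤ 0} = insert 0 {a : A | a ≠ 0 ∧ adeg F a = 0} := by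
    ext a
    simp only [Set.mem_ofPred_eq, Set.mem_insert_iff]
    by_cases ha : a = 0 <;> simp [ha]
  rw [hunion] at hfin ⊢
  rw [finsum_mem_insert _ (by simp) (hfin.subset (Set.subset_insert _ _)), zero_pow hs, zero_add]
  rfl

/-- Pairing `a` with `a + x` shows that power sums over a subgroup containing `x` lie in `(x)`. -/
lemma mk_finsum_pow_eq_zero [CharP A 2] {x : A} (hx0 : x ≠ 0) (W : AddSubgroup A)
    (hW : (W : Set A).Finite) (hx : x ∈ W) (s : ℕ) :
    Ideal.Quotient.mk (Ideal.span {x}) (∑ᶠ a ∈ (W : Set A), a ^ s) = 0 := by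
  have hmk : Ideal.Quotient.mk (Ideal.span {x}) x = 0 :=
    Ideal.Quotient.eq_zero_iff_mem.mpr (Ideal.mem_span_singleton_self x)
  rw [finsum_mem_eq_finite_toFinset_sum _ hW, map_sum]
  refine Finset.sum_involution (fun a _ => a + x) (fun a _ => ?_) (fun a _ _ => ?_)
    (fun a ha => ?_) (fun a _ => ?_)
  · rw [map_pow, map_pow, map_add, hmk, add_zero, ← map_pow, ← map_add,
      CharTwo.add_self_eq_zero, map_zero]
  · simpa using hx0
  · simpa using W.add_mem (by simpa using ha) hx
  · rw [add_assoc, CharTwo.add_self_eq_zero, add_zero]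

lemma zetaPoly_eq_sum_range {s n : ℕ} (h : ∀ d, n ≤ d → zetaCoeff F (A := A) s d = 0) :
    zetaPoly F A s = ∑ d ∈ Finset.range n, C (zetaCoeff F s d) * X ^ d := by
  refine finsum_eq_sum_of_support_subset _ fun d hd => ?_
  rw [Finset.coe_range, Set.mem_Iio]
  by_contra! hle
  exact hd (by simp [h d hle])

lemma coeff_zetaPoly {s n : ℕ} (h : ∀ d, n ≤ d → zetaCoeff F (A := A) s d = 0) (d : ℕ) :
    (zetaPoly F A s).coeff d = zetaCoeff F s d := by
  rw [zetaPoly_eq_sum_range h, finsetSum_coeff]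
  simp only [coeff_C_mul_X_pow, Finset.sum_ite_eq, Finset.mem_range]
  split_ifs with hd
  · rfl
  · exact (h d (not_lt.mp hd)).symm

end PowerSums



section RootMultiplicity

variable {R : Type*} [CommRing R] [CharP R 2]

lemma two_le_rootMultiplicity_one {p : R[X]} (hp : p ≠ 0) (h0 : p.eval 1 = 0)
    (hodd : ∀ d, Odd d → p.coeff d = 0) : 2 ≤ rootMultiplicity 1 p := by
  refine (one_lt_rootMultiplicity_iff_isRoot hp).mpr ⟨h0, ?_⟩
  have : derivative p = 0 := by
    ext d
    rw [coeff_derivative, coeff_zero]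
    rcases Nat.even_or_odd (d + 1) with h | h
    · have : ((d : R) + 1) = 0 := by
        exact_mod_cast (CharP.cast_eq_zero_iff R 2 (d + 1)).mpr h.two_dvd
      rw [this, mul_zero]
    · rw [hodd _ h, zero_mul]
  simp [this]

omit [CharP R 2] in
lemma rootMultiplicity_le_natDegree_map {S : Type*} [CommRing S] [Nontrivial S] (φ : R →+* S)
    (p : R[X]) (r : R) (hp : p.map φ ≠ 0) :
    rootMultiplicity r p ≤ (p.map φ).natDegree := by
  have h := Polynomial.map_dvd φ (pow_rootMultiplicity_dvd p r)
  simp only [Polynomial.map_pow, Polynomial.map_sub, map_X, map_C] at h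
  by_contra! hlt
  refine ((monic_X_sub_C (φ r)).pow (rootMultiplicity r p)).not_dvd_of_natDegree_lt hp ?_ h
  rwa [(monic_X_sub_C _).natDegree_pow, natDegree_X_sub_C, mul_one]

end RootMultiplicity

/-- Let `q = 2` and `A` an integral domain containing `F_2` with trivial
unit group, finite degrees `deg a = dim_{F_2}(A/aA)` for `a ≠ 0`, subspaces
`V_n = {a : a = 0 ∨ deg a ≤ n}` with `dim V_n = 1 + #{m ≤ n nongap}`, and finitely many
gaps, `g` in number.  If `A` is hyperelliptic (some `x ∈ A` has `deg x = 2`), then for every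
positive integer `s` with `l_2(s) ≤ g`, the zeta polynomial `Z_s(X)` (which has finitely many
nonzero coefficients) vanishes at `X = 1` to order exactly `2`. -/
theorem statement10 (A : Type*) [CommRing A] [IsDomain A] [Algebra (ZMod 2) A]
    (hunit : ∀ u : Aˣ, u = 1)
    (hdegfin : ∀ a : A, a ≠ 0 → Module.Finite (ZMod 2) (A ⧸ Ideal.span {a}))
    (V : ℕ → Submodule (ZMod 2) A)
    (hV : ∀ n : ℕ, (V n : Set A) = {a : A | a = 0 ∨ adeg (ZMod 2) a ≤ n})
    (hVdim : ∀ n : ℕ, Module.finrank (ZMod 2) (V n) =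
      1 + Set.ncard {m : ℕ | 1 ≤ m ∧ m ≤ n ∧ ¬ IsGapA (ZMod 2) A m})
    (g : ℕ) (hgfin : {m : ℕ | 1 ≤ m ∧ IsGapA (ZMod 2) A m}.Finite)
    (hg : {m : ℕ | 1 ≤ m ∧ IsGapA (ZMod 2) A m}.ncard = g)
    (x : A) (hx : adeg (ZMod 2) x = 2)
    (s : ℕ) (hs : 1 ≤ s) (hls : lq 2 s ≤ g) :
    {d : ℕ | zetaCoeff (ZMod 2) (A := A) s d ≠ 0}.Finite ∧
      rootMultiplicity 1 (zetaPoly (ZMod 2) A s) = 2 := by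
  have : CharP A 2 := charP_of_injective_algebraMap (algebraMap (ZMod 2) A).injective 2
  have hx0 : x ≠ 0 := ne_zero_of_adeg_eq_two hunit hgfin hx
  have hVset : ∀ n, {a : A | a = 0 ∨ adeg (ZMod 2) a ≤ n} = V n := fun n => (hV n).symm
  have hVfd : ∀ n, Module.Finite (ZMod 2) (V n) := fun n =>
    Module.finite_of_finrank_pos (by rw [hVdim]; omega)
  have hVfin : ∀ n, (V n : Set A).Finite := fun n =>
    have : Finite (V n) := Module.finite_of_finite (ZMod 2)
    Set.toFinite _
  have hfin : ∀ n, {a : A | a = 0 ∨ adeg (ZMod 2) a ≤ n}.Finite := fun n => by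
    rw [hVset]; exact hVfin n
  have hgpos : 1 ≤ g := by
    refine le_trans ?_ hls
    by_contra! h
    have h0 := DiffOrderLT.pow (A := A) s
    rw [Nat.lt_one_iff.mp h, zero_add] at h0
    simpa [zero_pow (Nat.one_le_iff_ne_zero.mp hs)] using h0 1 0
  have hrank : ∀ n, 2 * g ≤ n → lq 2 s + 1 ≤ Module.finrank (ZMod 2) (V n) := fun n hn => by
    rw [hVdim]
    have := le_ncard_nongaps hdegfin hx0 hx hn
    omega
  have hsum : ∀ n, 2 * g ≤ n → ∑ᶠ a ∈ {a : A | a = 0 ∨ adeg (ZMod 2) a ≤ n}, a ^ s = 0 :=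
    fun n hn => by
      rw [hVset]
      exact (DiffOrderLT.pow s).sum_submodule_eq_zero (V n) (hrank n hn)
  have hbig : ∀ d, 2 * g + 1 ≤ d → zetaCoeff (ZMod 2) (A := A) s d = 0 := by
    rintro (_ | d) hd
    · omega
    · have h := finsum_adeg_le_succ s d (hfin (d + 1))
      rwa [hsum (d + 1) (by omega), hsum d (by omega), zero_add, eq_comm] at h
  have hoddgap : ∀ d, Odd d → d < 2 * g → IsGapA (ZMod 2) A d := fun d hd hlt => by
    by_contra h
    have := two_mul_ncard_gaps_lt_of_odd hdegfin hx0 hx hd h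
    omega
  have hodd : ∀ d, Odd d → zetaCoeff (ZMod 2) (A := A) s d = 0 := fun d hd => by
    rcases lt_or_ge d (2 * g) with h | h
    · exact zetaCoeff_eq_zero_of_isGapA (hoddgap d hd h)
    · refine hbig d (lt_of_le_of_ne h ?_)
      rintro rfl
      exact (Nat.not_odd_iff_even.mpr (even_two_mul g)) hd
  have hT : ∀ n, ∑ᶠ a ∈ {a : A | a = 0 ∨ adeg (ZMod 2) a ≤ n}, a ^ s =
      ∑ d ∈ Finset.range (n + 1), zetaCoeff (ZMod 2) s d := fun n => by
    induction n with
    | zero => simpa using finsum_adeg_le_zero (by omega) (hfin 0)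
    | succ n ih => rw [finsum_adeg_le_succ s n (hfin (n + 1)), ih, Finset.sum_range_succ _ (n + 1)]
  have hcoeff := coeff_zetaPoly hbig
  have hzero := zetaCoeff_zero hunit hdegfin s
  refine ⟨(Set.finite_Iio (2 * g + 1)).subset fun d hd => ?_, le_antisymm ?_ ?_⟩
  · by_contra h
    exact hd (hbig d (not_lt.mp h))
  · set φ := Ideal.Quotient.mk (Ideal.span {x})
    have : Nontrivial (A ⧸ Ideal.span {x}) :=
      Module.nontrivial_of_finrank_pos (R := ZMod 2) (by rw [← adeg, hx]; exact two_pos)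
    have hφT : ∀ n, 2 ≤ n → φ (∑ d ∈ Finset.range (n + 1), zetaCoeff (ZMod 2) s d) = 0 :=
      fun n hn => by
        rw [← hT, hVset]
        refine mk_finsum_pow_eq_zero hx0 (V n).toAddSubgroup (hVfin n) ?_ s
        change x ∈ (V n : Set A)
        rw [hV]
        exact Or.inr (hx.trans_le hn)
    have hφ : ∀ d, 3 ≤ d → φ (zetaCoeff (ZMod 2) s d) = 0 := fun d hd => by
      obtain ⟨d, rfl⟩ := Nat.exists_eq_add_of_le' hd
      have h := hφT (d + 3) (by omega)
      rwa [Finset.sum_range_succ, map_add, hφT (d + 2) (by omega), zero_add] at h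
    refine (rootMultiplicity_le_natDegree_map φ _ 1 fun h => ?_).trans ?_
    · have := congrArg (coeff · 0) h
      simp [hcoeff, hzero] at this
    · rw [natDegree_le_iff_coeff_eq_zero]
      intro d hd
      rw [coeff_map, hcoeff, hφ d hd]
  · refine two_le_rootMultiplicity_one (fun h => ?_) ?_ fun d hd => by rw [hcoeff, hodd d hd]
    · have := hcoeff 0
      simp [h, hzero] at this
    · rw [zetaPoly_eq_sum_range hbig, eval_finsetSum]
      simpa using (hT (2 * g)).symm.trans (hsum _ le_rfl)
end

section
/- Let q = pⁿ be a prime power, a(x), b(x) ∈ F_q[x] with a ≠ 0, and A := F_q[x][y]/(y^q − a(x)^{q−1}y − b(x)). Assume: A is a Dedekind domain containing F_q with unit group A^× = F_q^×; N := dim_{F_q} A/(y) satisfies N > q·deg a(x) and gcd(N, p) = 1; for u := b(x)/a(x)^q ∈ F_q(x) and every irreducible m(x) ∈ F_q[x], if u = m(x)ⁿ·z with z ∈ F_q(x) having numerator and denominator prime to m(x) and n < 0, then gcd(n, p) = 1; deg c := dim_{F_q}(A/cA) is finite for every nonzero c ∈ A, each V_n := {c ∈ A : c = 0 or deg c ≤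 n} is an F_q-subspace with dim_{F_q} V_n = 1 + card{m : 1 ≤ m ≤ n, m not a gap of A}, the number g of gaps is finite, and A has an r-gap structure at ∞ (dim V_{iq} = i+1 for 1 ≤ i ≤ r, dim V_{g+r} = r+1, rq ≤ g+r) with r ≥ q − 1; the ideal class group of A is finite of order h with exponent e; for each d there are only finitely many nonzero ideals of degree d; and I_1, …, I_{h−1} are nonzero integral ideals representing all nontrivial ideal classes, with d_k := deg I_k = dim_{F_q}(A/I_k) and e_k the order of the class of I_k, such that I_k^{e_k} is generated by f_k, the image in A of an irreducible polynomial of F_q[x] dividing b(x). Let μ be a positive integer with N > qμ + e_k d_k for all k. Then for every positive integer s that is a multiple of q − 1 and satisfies l_q(es) ≤ μ(q−1) and l_q(es) ≤ r(q−1): for any choice of a generator c(I) of I^e for each nonzero ideal I, the power series Z(X) := ∑_{d≥0} X^d · ∑_{deg I = d} c(I)^{es} is independent of the choices (since (q−1) ∣ es and A^× = F_q^×), has only finitely many nonzero coefficients, and as a polynomial in A[X] is divisible by (X − 1)^q; i.e., ζ(−es) has multiplicity at least q. -/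
open Polynomial
open scoped nonZeroDivisors

/-- The degree of an ideal `I` of `A`: `deg I = dim_F (A / I)`. -/
noncomputable def idealDeg (F : Type*) {A : Type*} [Field F] [CommRing A] [Algebra F A]
    (I : Ideal A) : ℕ :=
  Module.finrank F (A ⧸ I)

/-- The `d`-th coefficient `∑_{I nonzero ideal, deg I = d} c(I)^m` of the ideal zeta
polynomial, where `c` is a choice of generator of `I^e` for each nonzero ideal `I`. -/
noncomputable def idealZetaCoeff (F : Type*) {A : Type*} [Field F] [CommRing A] [Algebra F A]
    (c : Ideal A → A) (m d : ℕ) : A :=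
  ∑ᶠ I ∈ {I : Ideal A | I ≠ ⊥ ∧ idealDeg F I = d}, (c I) ^ m

/-- The ideal zeta polynomial `Z(X) = ∑_{d ≥ 0} (∑_{deg I = d} c(I)^m) X^d ∈ A[X]`. -/
noncomputable def idealZeta (F : Type*) (A : Type*) [Field F] [CommRing A] [Algebra F A]
    (c : Ideal A → A) (m : ℕ) : Polynomial A :=
  ∑ᶠ d : ℕ, C (idealZetaCoeff F c m d) * X ^ d

/-- The coordinate ring `A = F_q[x][y]/(y^q − a(x)^{q−1} y − b(x))`. -/
noncomputable abbrev Aqgen (F : Type*) [Field F] (q : ℕ) (a b : F[X]) : Type _ :=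
  AdjoinRoot (X ^ q - C (a ^ (q - 1)) * X - C b : (F[X])[X])

/-- Chevalley's vanishing lemma for polynomials with coefficients in an algebra over a finite
field, summed over the rational points. -/
theorem sum_eval_algebraMap_eq_zero {F A σ : Type*} [Field F] [Fintype F] [CommRing A]
    [Algebra F A] [Fintype σ] [DecidableEq σ] (P : MvPolynomial σ A)
    (hP : P.totalDegree < (Fintype.card F - 1) * Fintype.card σ) :
    ∑ t : σ → F, MvPolynomial.eval (fun i => algebraMap F A (t i)) P = 0 := by
  classical
  simp_rw [MvPolynomial.eval_eq']
  rw [Finset.sum_comm]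
  refine Finset.sum_eq_zero fun m hm => ?_
  have h0 := MvPolynomial.sum_eval_eq_zero (MvPolynomial.monomial m (1 : F))
    (lt_of_le_of_lt ((MvPolynomial.totalDegree_monomial_le m 1).trans
      (MvPolynomial.le_totalDegree hm)) hP)
  have h1 := congrArg (algebraMap F A) h0
  simp only [MvPolynomial.eval_monomial, one_mul, map_sum, map_zero, Finsupp.prod_pow,
    map_prod, map_pow] at h1
  rw [← Finset.mul_sum, h1, mul_zero]

/-- A `k`-th power of a generic element of a subspace is a polynomial in the coordinates of
total degree at most the digit sum of `k`. -/
theorem exists_mvPolynomial_eval_eq_pow {F A σ : Type*} [Field F] [Fintype F] [CommRing A]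
    [Algebra F A] [Fintype σ] (L : List ℕ) (w : σ → A) :
    ∃ P : MvPolynomial σ A, P.totalDegree ≤ L.sum ∧ ∀ t : σ → F,
      MvPolynomial.eval (fun i => algebraMap F A (t i)) P =
        (∑ i, t i • w i) ^ Nat.ofDigits (Fintype.card F) L := by
  induction L generalizing w with
  | nil => exact ⟨1, by simp, by simp⟩
  | cons d L ih =>
    obtain ⟨P, hdeg, hev⟩ := ih (fun i => w i ^ Fintype.card F)
    refine ⟨(∑ i, MvPolynomial.C (w i) * MvPolynomial.X i) ^ d * P, ?_, fun t => ?_⟩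
    · rw [List.sum_cons]
      refine (MvPolynomial.totalDegree_mul _ _).trans (add_le_add ?_ hdeg)
      refine (MvPolynomial.totalDegree_pow _ _).trans ?_
      refine (Nat.mul_le_mul_left d ?_).trans_eq (mul_one d)
      refine (MvPolynomial.totalDegree_finsetSum _ _).trans (Finset.sup_le fun i _ => ?_)
      rw [MvPolynomial.C_mul_X_eq_monomial]
      exact (MvPolynomial.totalDegree_monomial_le _ _).trans (by simp)
    · obtain ⟨p, hp⟩ := CharP.exists F
      have hpp : Fact p.Prime := ⟨CharP.char_is_prime F p⟩
      obtain ⟨n, -, hn⟩ := FiniteField.card F p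
      have hA : ∀ g : σ → A, (∑ i, g i) ^ Fintype.card F = ∑ i, g i ^ Fintype.card F := by
        intro g
        rcases subsingleton_or_nontrivial A with hs | hs
        · exact Subsingleton.elim _ _
        have : CharP A p := charP_of_injective_algebraMap (algebraMap F A).injective p
        rw [hn, sum_pow_char_pow]
      rw [map_mul, hev, Nat.ofDigits_cons, pow_add, pow_mul, hA]
      congr 1
      · simp [Algebra.smul_def, mul_comm]
      · simp [_root_.smul_pow, FiniteField.pow_card]

/-- Power sums over a subspace vanish when the digit sum of the exponent is small. -/
theorem sum_submodule_pow_eq_zero {F A : Type*} [Field F] [Fintype F] [CommRing A]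
    [Algebra F A] (W : Submodule F A) [Fintype W] {k : ℕ}
    (hk : lq (Fintype.card F) k < (Fintype.card F - 1) * Module.finrank F W) :
    ∑ w : W, (w : A) ^ k = 0 := by
  classical
  let B := Module.finBasis F W
  obtain ⟨P, hdeg, hev⟩ := exists_mvPolynomial_eval_eq_pow (F := F)
    (Nat.digits (Fintype.card F) k) (fun i => (B i : A))
  have h0 := sum_eval_algebraMap_eq_zero (F := F) P
    (lt_of_le_of_lt hdeg (by rwa [Fintype.card_fin]))
  rw [← h0]
  refine Fintype.sum_equiv B.equivFun.toEquiv _ _ fun w => ?_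
  rw [hev, Nat.ofDigits_digits]
  congr 1
  have h1 := congrArg W.subtype (B.sum_equivFun w)
  rw [map_sum] at h1
  exact h1.symm

/-- The norm `#(A / I)` is multiplicative on an infinite Dedekind domain. -/
theorem cardQuot_mul_of_infinite {A : Type*} [CommRing A] [IsDedekindDomain A] [Infinite A]
    (I J : Ideal A) :
    Submodule.cardQuot (I * J) = Submodule.cardQuot I * Submodule.cardQuot J :=
  UniqueFactorizationMonoid.multiplicative_of_coprime Submodule.cardQuot I J
    (Submodule.cardQuot_bot _ _)
    (fun {I J} hI => by simp [Ideal.isUnit_iff.mp hI, Ideal.mul_top])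
    (fun {I} i hI =>
      have : Ideal.IsPrime I := Ideal.isPrime_of_prime hI
      cardQuot_pow_of_prime hI.ne_zero)
    fun {I J} hIJ => cardQuot_mul_of_coprime <| Ideal.isCoprime_iff_sup_eq.mpr
      (Ideal.isUnit_iff.mp
        (hIJ (Ideal.dvd_iff_le.mpr le_sup_left) (Ideal.dvd_iff_le.mpr le_sup_right)))

/-- `X ^ q - 1` divides a polynomial whose exponents lie in one residue class mod `q` and whose
coefficients sum to zero. -/
theorem X_pow_sub_one_dvd_sum {R : Type*} [CommRing R] (q M d₀ : ℕ) (S : ℕ → R)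
    (hres : ∀ d, S d ≠ 0 → q ∣ d + d₀) (hsum : ∑ d ∈ Finset.range M, S d = 0) :
    (X ^ q - 1 : R[X]) ∣ ∑ d ∈ Finset.range M, C (S d) * X ^ d := by
  have h1 : ∀ d, (X ^ q - 1 : R[X]) ∣ C (S d) * X ^ d - C (S d) * X ^ ((d₀ * (q - 1)) % q) := by
    intro d
    by_cases hd : S d = 0
    · simp [hd]
    have hmod : (d₀ * (q - 1)) % q = d % q := by
      rcases Nat.eq_zero_or_pos q with rfl | hq
      · have := hres d hd
        simp_all
      obtain ⟨q, rfl⟩ : ∃ r, q = r + 1 := ⟨q - 1, by omega⟩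
      obtain ⟨j, hj⟩ := hres d hd
      have : d + d₀ * (q + 1) = d₀ * q + (q + 1) * j := by linarith
      rw [Nat.add_sub_cancel, ← Nat.add_mul_mod_self_left (d₀ * q) (q + 1) j, ← this,
        Nat.add_mul_mod_self_right]
    rw [hmod, ← mul_sub]
    refine Dvd.dvd.mul_left ?_ _
    have h2 : (X ^ d : R[X]) - X ^ (d % q) = X ^ (d % q) * ((X ^ q) ^ (d / q) - 1) := by
      conv_lhs => rw [← Nat.mod_add_div d q, Nat.add_mul_mod_self_left, Nat.mod_mod]
      ring
    rw [h2]
    exact Dvd.dvd.mul_left (sub_one_dvd_pow_sub_one _ _) _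
  have h3 : ∑ d ∈ Finset.range M, C (S d) * X ^ d =
      ∑ d ∈ Finset.range M, (C (S d) * X ^ d - C (S d) * X ^ ((d₀ * (q - 1)) % q)) := by
    rw [Finset.sum_sub_distrib, ← Finset.sum_mul, ← map_sum, hsum]
    simp
  rw [h3]
  exact Finset.dvd_sum fun d _ => h1 d

section DedekindAlgebra

variable {F A : Type*} [Field F] [CommRing A] [Algebra F A]

open Classical in
/-- The finite set of elements of degree exactly `n` in an ideal. -/
noncomputable def elementsOfDeg (V : ℕ → Submodule F A) (hVfin : ∀ n, Finite (V n))
    (I : Ideal A) (n : ℕ) : Finset A :=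
  ((V n : Set A).toFinite).toFinset.filter fun α => α ∈ I ∧ α ≠ 0 ∧ adeg F α = n

open Classical in
/-- The finite set of nonzero ideals of degree `d` in the ideal class inverse to that of `I`. -/
noncomputable def idealsInverseTo
    (hIfin : ∀ d : ℕ, {I : Ideal A | I ≠ ⊥ ∧ idealDeg F I = d}.Finite)
    (I : Ideal A) (d : ℕ) : Finset (Ideal A) :=
  (hIfin d).toFinset.filter fun J => (J * I).IsPrincipal

theorem mem_elementsOfDeg {V : ℕ → Submodule F A} (hVfin : ∀ n, Finite (V n))
    (hV : ∀ m : ℕ, (V m : Set A) = {c : A | c = 0 ∨ adeg F c ≤ m}) {I : Ideal A} {n : ℕ} {α : A} :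
    α ∈ elementsOfDeg V hVfin I n ↔ α ∈ I ∧ α ≠ 0 ∧ adeg F α = n := by
  simp only [elementsOfDeg, Finset.mem_filter, Set.Finite.mem_toFinset, hV, Set.mem_ofPred_eq]
  exact ⟨fun h => h.2, fun h => ⟨Or.inr h.2.2.le, h⟩⟩

theorem mem_idealsInverseTo
    (hIfin : ∀ d : ℕ, {I : Ideal A | I ≠ ⊥ ∧ idealDeg F I = d}.Finite)
    {I J : Ideal A} {d : ℕ} : J ∈ idealsInverseTo hIfin I d ↔
      (J ≠ ⊥ ∧ idealDeg F J = d) ∧ (J * I).IsPrincipal := by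
  simp [idealsInverseTo]

theorem sum_elementsOfDeg {V : ℕ → Submodule F A} (hVfin : ∀ n, Finite (V n))
    (hV : ∀ m : ℕ, (V m : Set A) = {c : A | c = 0 ∨ adeg F c ≤ m}) (I : Ideal A) (n : ℕ)
    {k : ℕ} (hk : k ≠ 0) [Fintype (I.restrictScalars F ⊓ V n : Submodule F A)] :
    ∑ i ∈ Finset.range (n + 1), ∑ α ∈ elementsOfDeg V hVfin I i, α ^ k =
      ∑ w : (I.restrictScalars F ⊓ V n : Submodule F A), (w : A) ^ k := by
  classical
  have hmem : ∀ α, α ∈ V n ↔ α = 0 ∨ adeg F α ≤ n := fun α => by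
    rw [← SetLike.mem_coe, hV]; rfl
  let s : Finset A := (((V n : Set A).toFinite).toFinset.filter fun α => α ∈ I)
  have h1 : ∑ w : (I.restrictScalars F ⊓ V n : Submodule F A), (w : A) ^ k = ∑ α ∈ s, α ^ k := by
    refine (Finset.sum_subtype s (fun α => ?_) fun α : A => α ^ k).symm
    simp [s, and_comm]
  rw [h1, ← Finset.sum_filter_of_ne (s := s) (f := fun α => α ^ k) (p := fun α => α ≠ 0)
    (fun α _ h h0 => h (by rw [h0, zero_pow hk])),
    ← Finset.sum_fiberwise_of_maps_to (s := s.filter fun α => α ≠ 0) (g := adeg F)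
      (t := Finset.range (n + 1))]
  · refine Finset.sum_congr rfl fun i hi => Finset.sum_congr ?_ fun _ _ => rfl
    ext α
    have := Finset.mem_range.mp hi
    simp only [mem_elementsOfDeg hVfin hV, Finset.mem_filter, s, Set.Finite.mem_toFinset,
      SetLike.mem_coe, hmem]
    constructor
    · rintro ⟨h1, h2, h3⟩
      exact ⟨⟨⟨Or.inr (by omega), h1⟩, h2⟩, h3⟩
    · rintro ⟨⟨⟨-, h1⟩, h2⟩, h3⟩
      exact ⟨h1, h2, h3⟩
  · intro α hα
    simp only [Finset.mem_filter, s, Set.Finite.mem_toFinset, SetLike.mem_coe, hmem] at hα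
    rw [Finset.mem_range]
    have := hα.1.1.resolve_left hα.2
    omega

theorem idealZeta_congr {c c' : Ideal A → A} {t : ℕ}
    (h : ∀ J : Ideal A, J ≠ ⊥ → c J ^ t = c' J ^ t) :
    idealZeta F A c t = idealZeta F A c' t := by
  simp only [idealZeta, idealZetaCoeff]
  refine finsum_congr fun d => ?_
  congr 2
  exact finsum_mem_congr rfl fun J hJ => h J hJ.1

theorem idealZetaCoeff_eq_sum [IsDedekindDomain A] [Fintype (ClassGroup A)]
    (hIfin : ∀ d : ℕ, {I : Ideal A | I ≠ ⊥ ∧ idealDeg F I = d}.Finite)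
    (I : ClassGroup A → (Ideal A)⁰) (hI : ∀ κ, ClassGroup.mk0 (I κ) = κ⁻¹)
    (c : Ideal A → A) (t d : ℕ) :
    idealZetaCoeff F c t d = ∑ κ, ∑ J ∈ idealsInverseTo hIfin (I κ : Ideal A) d, c J ^ t := by
  classical
  let cls : Ideal A → ClassGroup A := fun J =>
    if h : J ≠ ⊥ then ClassGroup.mk0 ⟨J, mem_nonZeroDivisors_of_ne_zero h⟩ else 1
  rw [idealZetaCoeff, finsum_mem_eq_finite_toFinset_sum _ (hIfin d),
    ← Finset.sum_fiberwise _ cls]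
  refine Finset.sum_congr rfl fun κ _ => ?_
  rw [idealsInverseTo]
  refine Finset.sum_congr (Finset.filter_congr fun J hJ => ?_) fun _ _ => rfl
  have hJ0 : J ≠ ⊥ := ((Set.Finite.mem_toFinset _).mp hJ).1
  have hJ' : cls J = ClassGroup.mk0 ⟨J, mem_nonZeroDivisors_of_ne_zero hJ0⟩ := dif_pos hJ0
  rw [hJ', ← mul_inv_eq_one, ← hI, ← map_mul, ClassGroup.mk0_eq_one_iff]
  rfl

variable [Fintype F]

variable [Nontrivial A] in
theorem sub_one_pow_card : (X - 1 : A[X]) ^ Fintype.card F = X ^ Fintype.card F - 1 := by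
  obtain ⟨p, hp⟩ := CharP.exists F
  have hpp : Fact p.Prime := ⟨CharP.char_is_prime F p⟩
  obtain ⟨n, -, hn⟩ := FiniteField.card F p
  have : CharP A p := charP_of_injective_algebraMap (algebraMap F A).injective p
  rw [hn, sub_pow_char_pow, one_pow]

theorem cardQuot_eq_pow_idealDeg {I : Ideal A} (hI : Module.Finite F (A ⧸ I)) :
    Submodule.cardQuot I = Fintype.card F ^ idealDeg F I := by
  rw [Submodule.cardQuot_apply, idealDeg, Module.natCard_eq_pow_finrank (K := F),
    Nat.card_eq_fintype_card]

variable [IsDomain A] in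
/-- Generators of the ideals `J ^ e` have well-defined `t`-th powers when all units of `A` are
constants and `q - 1` divides `t`. -/
theorem pow_eq_of_span_eq {t : ℕ} (hunit : ∀ u : Aˣ, ∃ z : F, z ≠ 0 ∧ (u : A) = algebraMap F A z)
    (ht : (Fintype.card F - 1) ∣ t) {x y : A} (hxy : Ideal.span {x} = Ideal.span {y}) :
    x ^ t = y ^ t := by
  obtain ⟨u, rfl⟩ := Ideal.span_singleton_eq_span_singleton.mp hxy
  obtain ⟨z, hz, hu⟩ := hunit u
  obtain ⟨j, rfl⟩ := ht
  rw [mul_pow, hu, ← map_pow, pow_mul z, FiniteField.pow_card_sub_one_eq_one z hz]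
  simp

variable [IsDomain A] in
open Classical in
/-- The number of generators of a nonzero principal ideal. -/
theorem card_filter_span_eq (hunit : ∀ u : Aˣ, ∃ z : F, z ≠ 0 ∧ (u : A) = algebraMap F A z)
    {x : A} (hx : x ≠ 0) (s : Finset A) (hs : ∀ y, Ideal.span {y} = Ideal.span {x} → y ∈ s) :
    (s.filter fun y => Ideal.span {y} = Ideal.span {x}).card = Fintype.card F - 1 := by
  have : (s.filter fun y => Ideal.span {y} = Ideal.span {x}) =
      (Finset.univ : Finset Fˣ).image fun z : Fˣ => algebraMap F A (z : F) * x := by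
    ext y
    simp only [Finset.mem_filter, Finset.mem_image, Finset.mem_univ, true_and]
    constructor
    · rintro ⟨-, h⟩
      obtain ⟨u, rfl⟩ := Ideal.span_singleton_eq_span_singleton.mp h.symm
      obtain ⟨z, hz, hu⟩ := hunit u
      exact ⟨Units.mk0 z hz, by rw [hu, mul_comm]; rfl⟩
    · rintro ⟨z, rfl⟩
      have h : Ideal.span {algebraMap F A z * x} = Ideal.span {x} :=
        Ideal.span_singleton_mul_left_unit (z.isUnit.map (algebraMap F A)) x
      exact ⟨hs _ h, h⟩
  rw [this, Finset.card_image_of_injective, Finset.card_univ, Fintype.card_units]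
  intro z z' h
  exact Units.ext ((algebraMap F A).injective (mul_right_cancel₀ hx h))

variable [IsDedekindDomain A] [Infinite A]

theorem idealDeg_mul (hfin : ∀ I : Ideal A, I ≠ ⊥ → Module.Finite F (A ⧸ I)) {I J : Ideal A}
    (hI : I ≠ ⊥) (hJ : J ≠ ⊥) : idealDeg F (I * J) = idealDeg F I + idealDeg F J := by
  have h := cardQuot_mul_of_infinite I J
  rw [cardQuot_eq_pow_idealDeg (hfin _ hI), cardQuot_eq_pow_idealDeg (hfin _ hJ),
    cardQuot_eq_pow_idealDeg (hfin _ (mul_ne_zero hI hJ)), ← pow_add] at h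
  exact Nat.pow_right_injective (Fintype.one_lt_card (α := F)) h

theorem idealDeg_pow (hfin : ∀ I : Ideal A, I ≠ ⊥ → Module.Finite F (A ⧸ I)) {I : Ideal A}
    (hI : I ≠ ⊥) (i : ℕ) : idealDeg F (I ^ i) = i * idealDeg F I := by
  have h : Submodule.cardQuot (I ^ i) = Submodule.cardQuot I ^ i := by
    induction i with
    | zero => simp
    | succ i ih => rw [pow_succ, cardQuot_mul_of_infinite, ih, pow_succ]
  rw [cardQuot_eq_pow_idealDeg (hfin _ hI), cardQuot_eq_pow_idealDeg (hfin _ (pow_ne_zero _ hI)),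
    ← pow_mul] at h
  rw [Nat.pow_right_injective (Fintype.one_lt_card (α := F)) h, mul_comm]

theorem generator_pow_mul_sum_eq (hfin : ∀ I : Ideal A, I ≠ ⊥ → Module.Finite F (A ⧸ I))
    (hunit : ∀ u : Aˣ, ∃ z : F, z ≠ 0 ∧ (u : A) = algebraMap F A z)
    {V : ℕ → Submodule F A} (hVfin : ∀ n, Finite (V n))
    (hV : ∀ m : ℕ, (V m : Set A) = {c : A | c = 0 ∨ adeg F c ≤ m})
    (hIfin : ∀ d : ℕ, {I : Ideal A | I ≠ ⊥ ∧ idealDeg F I = d}.Finite)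
    {e t : ℕ} (ht : (Fintype.card F - 1) ∣ t) {c : Ideal A → A}
    (hc : ∀ J : Ideal A, J ≠ ⊥ → Ideal.span {c J} = J ^ e)
    {I : Ideal A} (hI : I ≠ ⊥) {φ : A} (hφ : Ideal.span {φ} = I ^ e) (d : ℕ) :
    φ ^ t * ∑ J ∈ idealsInverseTo hIfin I d, c J ^ t =
      -∑ α ∈ elementsOfDeg V hVfin I (d + idealDeg F I), α ^ (e * t) := by
  classical
  let S := (idealsInverseTo hIfin I d).image fun J => J * I
  have hmaps : ∀ α ∈ elementsOfDeg V hVfin I (d + idealDeg F I), Ideal.span {α} ∈ S := by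
    intro α hα
    obtain ⟨hαI, hα0, hα⟩ := (mem_elementsOfDeg hVfin hV).mp hα
    obtain ⟨J, hJ⟩ := Ideal.dvd_iff_le.mpr ((Ideal.span_singleton_le_iff_mem I).mpr hαI)
    rw [mul_comm] at hJ
    have hJ0 : J ≠ ⊥ := by
      rintro rfl
      rw [Ideal.bot_mul] at hJ
      exact hα0 (Ideal.span_singleton_eq_bot.mp hJ)
    have hdeg := idealDeg_mul hfin hJ0 hI
    rw [← hJ] at hdeg
    change adeg F α = _ at hdeg
    refine Finset.mem_image.mpr ⟨J, (mem_idealsInverseTo hIfin).mpr ⟨⟨hJ0, by omega⟩, ?_⟩, hJ.symm⟩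
    rw [← hJ]
    exact ⟨α, rfl⟩
  rw [← Finset.sum_fiberwise_of_maps_to hmaps, Finset.sum_image
    (fun J _ J' _ h => mul_right_cancel₀ hI h), Finset.mul_sum, ← Finset.sum_neg_distrib]
  refine Finset.sum_congr rfl fun J hJ => ?_
  obtain ⟨⟨hJ0, hJd⟩, x, hx⟩ := (mem_idealsInverseTo hIfin).mp hJ
  change J * I = Ideal.span {x} at hx
  have hx0 : x ≠ 0 := by
    rintro rfl
    rw [Ideal.span_singleton_eq_bot.mpr rfl] at hx
    exact mul_ne_zero hJ0 hI hx
  have hmem : ∀ y, Ideal.span {y} = Ideal.span {x} →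
      y ∈ elementsOfDeg V hVfin I (d + idealDeg F I) := by
    intro y hy
    rw [← hx] at hy
    refine (mem_elementsOfDeg hVfin hV).mpr ⟨?_, ?_, ?_⟩
    · exact Ideal.mul_le_right (I := J) (hy ▸ Ideal.mem_span_singleton_self y)
    · rintro rfl
      rw [Ideal.span_singleton_eq_bot.mpr rfl] at hy
      exact mul_ne_zero hJ0 hI hy.symm
    · rw [adeg, hy, ← hJd]
      exact idealDeg_mul hfin hJ0 hI
  have hval : ∀ y ∈ (elementsOfDeg V hVfin I (d + idealDeg F I)).filter
      (fun y => Ideal.span {y} = J * I), y ^ (e * t) = φ ^ t * c J ^ t := by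
    intro y hy
    rw [pow_mul, ← mul_pow]
    refine pow_eq_of_span_eq hunit ht ?_
    rw [← Ideal.span_singleton_pow, (Finset.mem_filter.mp hy).2,
      ← Ideal.span_singleton_mul_span_singleton, hφ, hc J hJ0, mul_pow, mul_comm]
  rw [Finset.sum_congr rfl hval, Finset.sum_const, hx, card_filter_span_eq hunit hx0 _ hmem,
    nsmul_eq_mul, Nat.cast_sub Fintype.card_pos, ← map_natCast (algebraMap F A),
    FiniteField.cast_card_eq_zero]
  simp

theorem sum_idealsInverseTo (hfin : ∀ I : Ideal A, I ≠ ⊥ → Module.Finite F (A ⧸ I))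
    (hunit : ∀ u : Aˣ, ∃ z : F, z ≠ 0 ∧ (u : A) = algebraMap F A z)
    {V : ℕ → Submodule F A} (hVfin : ∀ n, Finite (V n))
    (hV : ∀ m : ℕ, (V m : Set A) = {c : A | c = 0 ∨ adeg F c ≤ m})
    (hIfin : ∀ d : ℕ, {I : Ideal A | I ≠ ⊥ ∧ idealDeg F I = d}.Finite)
    {e t : ℕ} (he : e ≠ 0) (ht0 : t ≠ 0) (ht : (Fintype.card F - 1) ∣ t) {c : Ideal A → A}
    (hc : ∀ J : Ideal A, J ≠ ⊥ → Ideal.span {c J} = J ^ e)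
    {I : Ideal A} (hI : I ≠ ⊥) {φ : A} (hφ : Ideal.span {φ} = I ^ e) {m : ℕ}
    (hm : ∀ α ∈ I, α ≠ 0 → adeg F α ≤ m → Fintype.card F ∣ adeg F α)
    (hdim : lq (Fintype.card F) (e * t) <
      (Fintype.card F - 1) * Module.finrank F (I.restrictScalars F ⊓ V m : Submodule F A)) :
    (∀ d, ∑ J ∈ idealsInverseTo hIfin I d, c J ^ t ≠ 0 →
      d ≤ m ∧ Fintype.card F ∣ d + idealDeg F I) ∧
    ∑ d ∈ Finset.range (m + 1), ∑ J ∈ idealsInverseTo hIfin I d, c J ^ t = 0 := by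
  classical
  have hk : e * t ≠ 0 := mul_ne_zero he ht0
  have hφ0 : φ ^ t ≠ 0 := by
    refine pow_ne_zero _ ?_
    rintro rfl
    rw [Ideal.span_singleton_eq_bot.mpr rfl] at hφ
    exact pow_ne_zero e hI hφ.symm
  have hS := generator_pow_mul_sum_eq hfin hunit hVfin hV hIfin ht hc hI hφ
  let T : ℕ → A := fun i => ∑ α ∈ elementsOfDeg V hVfin I i, α ^ (e * t)
  have hVmono : ∀ n, m ≤ n → V m ≤ V n := by
    intro n hn x hx
    rw [← SetLike.mem_coe, hV] at hx ⊢
    exact hx.imp_right fun h => h.trans hn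
  have hU : ∀ n, m ≤ n → ∑ i ∈ Finset.range (n + 1), T i = 0 := by
    intro n hn
    have : Finite (I.restrictScalars F ⊓ V n : Submodule F A) :=
      Finite.of_injective _ (Submodule.inclusion_injective inf_le_right)
    have := Fintype.ofFinite (I.restrictScalars F ⊓ V n : Submodule F A)
    rw [sum_elementsOfDeg hVfin hV I n hk]
    refine sum_submodule_pow_eq_zero _ (hdim.trans_le (Nat.mul_le_mul_left _ ?_))
    exact Submodule.finrank_mono (inf_le_inf_left _ (hVmono n hn))
  have hT : ∀ n, m < n → T n = 0 := by
    intro n hn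
    obtain ⟨n, rfl⟩ : ∃ j, n = j + 1 := ⟨n - 1, by omega⟩
    have h1 := hU (n + 1) (by omega)
    rwa [Finset.sum_range_succ, hU n (by omega), zero_add] at h1
  have hTlow : ∀ n, n < idealDeg F I → T n = 0 := by
    intro n hn
    refine Finset.sum_eq_zero fun α hα => ?_
    exfalso
    obtain ⟨hαI, hα0, hα⟩ := (mem_elementsOfDeg hVfin hV).mp hα
    obtain ⟨J, hJ⟩ := Ideal.dvd_iff_le.mpr ((Ideal.span_singleton_le_iff_mem I).mpr hαI)
    have hJ0 : J ≠ ⊥ := by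
      rintro rfl
      rw [Ideal.mul_bot] at hJ
      exact hα0 (Ideal.span_singleton_eq_bot.mp hJ)
    have hdeg := idealDeg_mul hfin hI hJ0
    rw [← hJ] at hdeg
    change adeg F α = _ at hdeg
    omega
  refine ⟨fun d hd => ?_, ?_⟩
  · have hne : T (d + idealDeg F I) ≠ 0 := by
      intro h0
      have := hS d
      rw [show ∑ α ∈ elementsOfDeg V hVfin I (d + idealDeg F I), α ^ (e * t) = 0 from h0,
        neg_zero] at this
      exact (mul_ne_zero hφ0 hd) this
    have hle : d + idealDeg F I ≤ m := by
      by_contra h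
      exact hne (hT _ (by omega))
    obtain ⟨α, hα, -⟩ := Finset.exists_ne_zero_of_sum_ne_zero hne
    obtain ⟨hαI, hα0, hα⟩ := (mem_elementsOfDeg hVfin hV).mp hα
    exact ⟨by omega, hα ▸ hm α hαI hα0 (by omega)⟩
  · refine (mul_eq_zero.mp (?_ : φ ^ t * _ = 0)).resolve_left hφ0
    rw [Finset.mul_sum, Finset.sum_congr rfl fun d _ => hS d, Finset.sum_neg_distrib, neg_eq_zero]
    have h1 := hU (idealDeg F I + m) (by omega)
    rw [add_assoc, Finset.sum_range_add, Finset.sum_eq_zero fun n hn =>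
      hTlow n (Finset.mem_range.mp hn), zero_add] at h1
    rw [← h1]
    exact Finset.sum_congr rfl fun d _ => by rw [add_comm d]

theorem X_pow_card_sub_one_dvd_idealZeta [Finite (ClassGroup A)]
    (hfin : ∀ I : Ideal A, I ≠ ⊥ → Module.Finite F (A ⧸ I))
    (hunit : ∀ u : Aˣ, ∃ z : F, z ≠ 0 ∧ (u : A) = algebraMap F A z)
    {V : ℕ → Submodule F A} (hVfin : ∀ n, Finite (V n))
    (hV : ∀ m : ℕ, (V m : Set A) = {c : A | c = 0 ∨ adeg F c ≤ m})
    (hIfin : ∀ d : ℕ, {I : Ideal A | I ≠ ⊥ ∧ idealDeg F I = d}.Finite)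
    {e t : ℕ} (he : Monoid.exponent (ClassGroup A) = e) (ht0 : t ≠ 0)
    (ht : (Fintype.card F - 1) ∣ t)
    (hI : ∀ κ : ClassGroup A, ∃ I : (Ideal A)⁰, ClassGroup.mk0 I = κ ∧ ∃ m : ℕ,
      (∀ α ∈ (I : Ideal A), α ≠ 0 → adeg F α ≤ m → Fintype.card F ∣ adeg F α) ∧
      lq (Fintype.card F) (e * t) < (Fintype.card F - 1) *
        Module.finrank F ((I : Ideal A).restrictScalars F ⊓ V m : Submodule F A))
    {c : Ideal A → A} (hc : ∀ J : Ideal A, J ≠ ⊥ → Ideal.span {c J} = J ^ e) :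
    {d : ℕ | idealZetaCoeff F c t d ≠ 0}.Finite ∧
      (X ^ Fintype.card F - 1 : A[X]) ∣ idealZeta F A c t := by
  have := Fintype.ofFinite (ClassGroup A)
  have he0 : e ≠ 0 := he ▸ Monoid.exponent_ne_zero_of_finite
  choose I hmk m hm hdim using fun κ : ClassGroup A => hI κ⁻¹
  have hI0 : ∀ κ, (I κ : Ideal A) ≠ ⊥ := fun κ => nonZeroDivisors.coe_ne_zero (I κ)
  have hφ : ∀ κ, ∃ φ : A, Ideal.span {φ} = (I κ : Ideal A) ^ e := by
    intro κ
    have h1 : ClassGroup.mk0 (I κ ^ e) = 1 := by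
      rw [map_pow, ← he, Monoid.pow_exponent_eq_one]
    obtain ⟨φ, hφ⟩ := (ClassGroup.mk0_eq_one_iff (I κ ^ e).2).mp h1
    exact ⟨φ, by rw [← SubmonoidClass.coe_pow]; exact hφ.symm⟩
  choose φ hφ using hφ
  let S : ClassGroup A → ℕ → A := fun κ d =>
    ∑ J ∈ idealsInverseTo hIfin (I κ : Ideal A) d, c J ^ t
  have hS : ∀ κ, (∀ d, S κ d ≠ 0 → d ≤ m κ ∧ Fintype.card F ∣ d + idealDeg F (I κ : Ideal A)) ∧
      ∑ d ∈ Finset.range (m κ + 1), S κ d = 0 := fun κ =>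
    sum_idealsInverseTo hfin hunit hVfin hV hIfin he0 ht0 ht hc (hI0 κ) (hφ κ) (hm κ) (hdim κ)
  have hcoeff : ∀ d, idealZetaCoeff F c t d = ∑ κ, S κ d :=
    idealZetaCoeff_eq_sum hIfin I hmk c t
  let M := Finset.univ.sup m + 1
  have hmM : ∀ κ, m κ < M := fun κ => Nat.lt_succ_of_le (Finset.le_sup (Finset.mem_univ κ))
  have hbound : ∀ d, idealZetaCoeff F c t d ≠ 0 → d < M := by
    intro d hd
    rw [hcoeff] at hd
    obtain ⟨κ, -, hκ⟩ := Finset.exists_ne_zero_of_sum_ne_zero hd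
    exact ((hS κ).1 d hκ).1.trans_lt (hmM κ)
  refine ⟨(Set.finite_lt_nat M).subset hbound, ?_⟩
  have hZ : idealZeta F A c t = ∑ κ, ∑ d ∈ Finset.range M, C (S κ d) * X ^ d := by
    rw [idealZeta, finsum_eq_sum_of_support_subset (s := Finset.range M), Finset.sum_comm]
    · refine Finset.sum_congr rfl fun d _ => ?_
      rw [hcoeff, map_sum, Finset.sum_mul]
    · intro d hd
      rw [Finset.coe_range, Set.mem_Iio]
      refine hbound d fun h0 => hd ?_
      simp [h0]
  rw [hZ]
  refine Finset.dvd_sum fun κ _ => X_pow_sub_one_dvd_sum _ M (idealDeg F (I κ : Ideal A)) (S κ)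
    (fun d hd => ((hS κ).1 d hd).2) ?_
  rw [← (hS κ).2]
  refine (Finset.sum_subset (Finset.range_mono (hmM κ)) fun d _ hd => ?_).symm
  by_contra h
  exact hd (Finset.mem_range.mpr (Nat.lt_succ_of_le ((hS κ).1 d h).1))

end DedekindAlgebra

/-- A sum of elements of pairwise distinct degrees has the degree of one of its terms. -/
theorem exists_adeg_sum_eq {F A ι : Type*} [Field F] [CommRing A] [Algebra F A]
    {V : ℕ → Submodule F A}
    (hV : ∀ m : ℕ, (V m : Set A) = {c : A | c = 0 ∨ adeg F c ≤ m}) (s : Finset ι) (f : ι → A)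
    (hf : ∀ i ∈ s, ∀ j ∈ s, f i ≠ 0 → f j ≠ 0 → adeg F (f i) = adeg F (f j) → i = j)
    (h0 : ∑ i ∈ s, f i ≠ 0) :
    ∃ i ∈ s, f i ≠ 0 ∧ adeg F (∑ i ∈ s, f i) = adeg F (f i) := by
  classical
  have hmem : ∀ m α, α ∈ V m ↔ α = 0 ∨ adeg F α ≤ m := fun m α => by
    rw [← SetLike.mem_coe, hV]; rfl
  obtain ⟨i₁, hi₁, hi₁0⟩ := Finset.exists_ne_zero_of_sum_ne_zero h0
  obtain ⟨i, hi, hmax⟩ := Finset.exists_max_image (s.filter fun i => f i ≠ 0)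
    (fun i => adeg F (f i)) ⟨i₁, Finset.mem_filter.mpr ⟨hi₁, hi₁0⟩⟩
  obtain ⟨his, hi0⟩ := Finset.mem_filter.mp hi
  refine ⟨i, his, hi0, le_antisymm ?_ ?_⟩
  · refine ((hmem _ _).mp (Submodule.sum_mem _ fun j hj => (hmem _ _).mpr ?_)).resolve_left h0
    by_cases hj0 : f j = 0
    · exact Or.inl hj0
    · exact Or.inr (hmax j (Finset.mem_filter.mpr ⟨hj, hj0⟩))
  · by_contra! hlt
    have h1 : ∑ j ∈ s, f j - ∑ j ∈ s.erase i, f j ∈ V (adeg F (f i) - 1) := by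
      refine Submodule.sub_mem _ ((hmem _ _).mpr (Or.inr (by omega)))
        (Submodule.sum_mem _ fun j hj => (hmem _ _).mpr ?_)
      obtain ⟨hji, hjs⟩ := Finset.mem_erase.mp hj
      by_cases hj0 : f j = 0
      · exact Or.inl hj0
      · have h2 := hmax j (Finset.mem_filter.mpr ⟨hjs, hj0⟩)
        have h3 : adeg F (f j) ≠ adeg F (f i) := fun h => hji (hf j hjs i his hj0 hi0 h)
        right
        omega
    rw [← eq_sub_of_add_eq (Finset.add_sum_erase s f his)] at h1
    have := ((hmem _ _).mp h1).resolve_left hi0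
    omega

section ArtinSchreier

variable {F : Type*} [Field F] {q : ℕ} {a b : F[X]}

theorem definingPolynomial_monic_natDegree (hq : 1 < q) (a b : F[X]) :
    (X ^ q - C (a ^ (q - 1)) * X - C b : F[X][X]).Monic ∧
      (X ^ q - C (a ^ (q - 1)) * X - C b : F[X][X]).natDegree = q := by
  have h : (C (a ^ (q - 1)) * X + C b : F[X][X]).degree < q :=
    degree_linear_le.trans_lt (by exact_mod_cast hq)
  rw [sub_sub]
  refine ⟨monic_X_pow_sub h, natDegree_eq_of_degree_eq_some ?_⟩
  rw [degree_sub_eq_left_of_degree_lt (by rwa [degree_X_pow]), degree_X_pow]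

/-- The basis `1, y, …, y^(q-1)` of `A` over `F[x]`. -/
noncomputable def powBasis (hq : 1 < q) (a b : F[X]) : Module.Basis (Fin q) F[X] (Aqgen F q a b) :=
  (AdjoinRoot.powerBasis' (definingPolynomial_monic_natDegree hq a b).1).basis.reindex
    (finCongr (definingPolynomial_monic_natDegree hq a b).2)

theorem powBasis_apply (hq : 1 < q) (a b : F[X]) (i : Fin q) :
    powBasis hq a b i = AdjoinRoot.root (X ^ q - C (a ^ (q - 1)) * X - C b) ^ (i : ℕ) := by
  rw [powBasis, Module.Basis.reindex_apply, PowerBasis.basis_eq_pow]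
  rfl

theorem root_pow_eq (a b : F[X]) :
    AdjoinRoot.root (X ^ q - C (a ^ (q - 1)) * X - C b) ^ q =
      algebraMap F[X] (Aqgen F q a b) (a ^ (q - 1)) *
        AdjoinRoot.root (X ^ q - C (a ^ (q - 1)) * X - C b) +
      algebraMap F[X] (Aqgen F q a b) b := by
  have h := AdjoinRoot.eval₂_root (X ^ q - C (a ^ (q - 1)) * X - C b)
  simp only [eval₂_sub, eval₂_mul, eval₂_X_pow, eval₂_C, eval₂_X] at h
  rw [AdjoinRoot.algebraMap_eq]
  linear_combination h

theorem root_ne_zero (hq : 1 < q) (a b : F[X]) :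
    AdjoinRoot.root (X ^ q - C (a ^ (q - 1)) * X - C b) ≠ 0 := by
  have := (powBasis hq a b).ne_zero ⟨1, hq⟩
  rwa [powBasis_apply, pow_one] at this

theorem adeg_one_s13 : adeg F (1 : Aqgen F q a b) = 0 := by
  rw [adeg, Ideal.span_singleton_one]
  exact Module.finrank_zero_of_subsingleton

/-- Multiples of `g ∈ F[x]` by polynomials of degree less than `n`, as a linear map to `A`. -/
noncomputable def mulDegreeLT (q : ℕ) (a b g : F[X]) (n : ℕ) :
    degreeLT F n →ₗ[F] Aqgen F q a b :=
  (IsScalarTower.toAlgHom F F[X] (Aqgen F q a b)).toLinearMap ∘ₗ LinearMap.mulLeft F g ∘ₗ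
    (degreeLT F n).subtype

theorem finrank_degreeLT (n : ℕ) : Module.finrank F (degreeLT F n) = n := by
  rw [(degreeLTEquiv F n).finrank_eq, Module.finrank_fin_fun]

theorem exists_eval₂_pow_eq [Fintype F] {S : Type*} [CommRing S] (hcard : Fintype.card F = q)
    {f : F[X]} (hf : Irreducible f) (hfa : ¬ f ∣ a) {π : F[X] →+* S} (hπf : π f = 0) {y : S}
    (hy : y ^ q = π a ^ (q - 1) * y) :
    ∃ Q, 1 < Q ∧ ∀ G : F[X][X], G.eval₂ π y ^ Q = G.eval₂ π y := by
  have : Fact (Irreducible f) := ⟨hf⟩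
  have hq1 : 1 < q := hcard ▸ Fintype.one_lt_card
  have hπ : ∀ g, f ∣ g → π g = 0 := by
    rintro _ ⟨g, rfl⟩
    rw [map_mul, hπf, zero_mul]
  have : Module.Finite F (AdjoinRoot f) := (AdjoinRoot.powerBasis hf.ne_zero).finite
  have : Finite (AdjoinRoot f) := Module.finite_of_finite F
  have := Fintype.ofFinite (AdjoinRoot f)
  set m := Module.finrank F (AdjoinRoot f)
  have hQ : Fintype.card (AdjoinRoot f) = q ^ m := hcard ▸ Module.card_eq_pow_finrank
  have hπpow : ∀ g, π g ^ q ^ m = π g := by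
    intro g
    rw [← map_pow, ← sub_eq_zero, ← map_sub]
    refine hπ _ (AdjoinRoot.mk_eq_zero.mp ?_)
    rw [map_sub, map_pow, ← hQ, FiniteField.pow_card, sub_self]
  have hypow : ∀ j, π a * y ^ q ^ j = π a ^ q ^ j * y := by
    intro j
    induction j with
    | zero => simp
    | succ j ih =>
      calc π a * y ^ q ^ (j + 1) = (π a ^ (q - 1)) ^ q ^ j * (π a * y ^ q ^ j) := by
            rw [pow_succ', pow_mul, hy, mul_pow]; ring
        _ = (π a ^ (q - 1) * π a) ^ q ^ j * y := by rw [ih, mul_pow]; ring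
        _ = π a ^ q ^ (j + 1) * y := by
            rw [← pow_succ, Nat.sub_add_cancel hq1.le, ← pow_mul, ← pow_succ']
  have hunit : IsUnit (π a) := by
    obtain ⟨u, v, huv⟩ := (hf.coprime_iff_not_dvd).mpr hfa
    refine IsUnit.of_mul_eq_one (π v) ?_
    have h := congrArg π huv
    rw [map_add, hπ _ (dvd_mul_left f u), zero_add, map_one, map_mul] at h
    rw [mul_comm, h]
  have hyQ : y ^ q ^ m = y := by
    refine hunit.mul_left_cancel ?_
    rw [hypow, hπpow]
  refine ⟨q ^ m, hQ ▸ Fintype.one_lt_card, fun G => ?_⟩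
  rcases subsingleton_or_nontrivial S with hs | hs
  · exact Subsingleton.elim _ _
  obtain ⟨p, hp⟩ := CharP.exists F
  have hpp : Fact p.Prime := ⟨CharP.char_is_prime F p⟩
  obtain ⟨n, -, hn⟩ := FiniteField.card F p
  have : CharP S p := charP_of_injective_ringHom (π.comp C).injective p
  have hqm : q ^ m = p ^ ((n : ℕ) * m) := by rw [← hcard, hn, pow_mul]
  have heq : (iterateFrobenius S p (n * m)).comp (eval₂RingHom π y) = eval₂RingHom π y := by
    refine Polynomial.ringHom_ext (fun g => ?_) ?_
    · rw [RingHom.comp_apply, iterateFrobenius_def, ← hqm, coe_eval₂RingHom, eval₂_C, hπpow]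
    · rw [RingHom.comp_apply, iterateFrobenius_def, ← hqm, coe_eval₂RingHom, eval₂_X, hyQ]
  rw [hqm]
  exact RingHom.congr_fun heq G

/-- An irreducible polynomial `f` not dividing `a` generates a radical ideal in an extension
generated by an element satisfying the Artin-Schreier equation modulo `f`. -/
theorem isRadical_span_of_pow_eq [Fintype F] {B : Type*} [CommRing B] [Algebra F[X] B]
    (hcard : Fintype.card F = q) {f : F[X]} (hf : Irreducible f) (hfb : f ∣ b) (hfa : ¬ f ∣ a)
    {y : B} (hy : y ^ q = algebraMap F[X] B (a ^ (q - 1)) * y + algebraMap F[X] B b)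
    (hsurj : ∀ z : B, ∃ G : F[X][X], aeval y G = z) :
    (Ideal.span {algebraMap F[X] B f}).IsRadical := by
  set J := Ideal.span {algebraMap F[X] B f}
  let π : F[X] →+* B ⧸ J := (Ideal.Quotient.mk J).comp (algebraMap F[X] B)
  have hπ : ∀ g, f ∣ g → π g = 0 := fun g hg => Ideal.Quotient.eq_zero_iff_mem.mpr
    (Ideal.mem_span_singleton.mpr (map_dvd _ hg))
  have hy : (Ideal.Quotient.mk J y) ^ q = π (a ^ (q - 1)) * Ideal.Quotient.mk J y + π b :=
    congrArg (Ideal.Quotient.mk J) hy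
  rw [hπ b hfb, add_zero, map_pow] at hy
  obtain ⟨Q, hQ1, hQ⟩ := exists_eval₂_pow_eq hcard hf hfa (hπ f dvd_rfl) hy
  have hpow : ∀ z : B, Ideal.Quotient.mk J z ^ Q = Ideal.Quotient.mk J z := by
    intro z
    obtain ⟨G, rfl⟩ := hsurj z
    rw [aeval_def, hom_eval₂, hQ]
  rintro z ⟨k, hk⟩
  have hiter : ∀ j, (Ideal.Quotient.mk J z) ^ Q ^ j = Ideal.Quotient.mk J z := by
    intro j
    induction j with
    | zero => simp
    | succ j ih => rw [pow_succ, pow_mul, ih, hpow]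
  rw [← Ideal.Quotient.eq_zero_iff_mem] at hk ⊢
  rw [← hiter k]
  exact pow_eq_zero_of_le (Nat.lt_pow_self hQ1).le (by rwa [map_pow] at hk)

theorem eval₂_definingPolynomial_zero (hq : 1 < q) {f : F[X]} (hfb : f ∣ b) :
    (X ^ q - C (a ^ (q - 1)) * X - C b : F[X][X]).eval₂ (AdjoinRoot.mk f) 0 = 0 := by
  simp [AdjoinRoot.mk_eq_zero.mpr hfb, zero_pow (by omega : q ≠ 0)]

/-- Reduction of `A` modulo `f` and `y`. -/
noncomputable def reduction (hq : 1 < q) (a : F[X]) {f : F[X]} (hfb : f ∣ b) :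
    Aqgen F q a b →ₐ[F] AdjoinRoot f :=
  { AdjoinRoot.lift (AdjoinRoot.mk f) 0 (eval₂_definingPolynomial_zero hq hfb) with
    commutes' := fun _ => AdjoinRoot.lift_of (eval₂_definingPolynomial_zero hq hfb) }

theorem reduction_algebraMap (hq : 1 < q) {f : F[X]} (hfb : f ∣ b) (g : F[X]) :
    reduction hq a hfb (algebraMap F[X] (Aqgen F q a b) g) = AdjoinRoot.mk f g :=
  AdjoinRoot.lift_of (eval₂_definingPolynomial_zero hq hfb)

theorem reduction_root (hq : 1 < q) {f : F[X]} (hfb : f ∣ b) :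
    reduction hq a hfb (AdjoinRoot.root (X ^ q - C (a ^ (q - 1)) * X - C b)) = 0 :=
  AdjoinRoot.lift_root (eval₂_definingPolynomial_zero hq hfb)

theorem idealDeg_ker_reduction (hq : 1 < q) {f : F[X]} (hf : f ≠ 0) (hfb : f ∣ b) :
    idealDeg F (RingHom.ker (reduction hq a hfb)) = f.natDegree := by
  have hsurj : Function.Surjective (reduction hq a hfb) := fun z => by
    obtain ⟨g, rfl⟩ := AdjoinRoot.mk_surjective z
    exact ⟨_, reduction_algebraMap hq hfb g⟩
  rw [idealDeg, (Ideal.quotientKerAlgEquivOfSurjective hsurj).toLinearEquiv.finrank_eq,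
    (AdjoinRoot.powerBasis hf).finrank, AdjoinRoot.powerBasis_dim]

theorem ker_reduction_le_radical (hq : 1 < q) {f : F[X]} (hfa : f ∣ a) (hfb : f ∣ b) :
    RingHom.ker (reduction hq a hfb) ≤
      (Ideal.span {algebraMap F[X] (Aqgen F q a b) f}).radical := by
  have hmem : ∀ g, f ∣ g → algebraMap F[X] (Aqgen F q a b) g ∈
      Ideal.span {algebraMap F[X] (Aqgen F q a b) f} := fun g hg =>
    Ideal.mem_span_singleton.mpr (map_dvd _ hg)
  intro z hz
  obtain ⟨G, rfl⟩ := AdjoinRoot.mk_surjective z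
  have hG : AdjoinRoot.mk (X ^ q - C (a ^ (q - 1)) * X - C b) G =
      AdjoinRoot.mk _ G.divX * AdjoinRoot.root _ + algebraMap F[X] _ (G.coeff 0) := by
    conv_lhs => rw [← divX_mul_X_add G, map_add, map_mul, AdjoinRoot.mk_X]
    rfl
  rw [hG] at hz ⊢
  rw [RingHom.mem_ker, map_add, map_mul, reduction_root, mul_zero, zero_add,
    reduction_algebraMap, AdjoinRoot.mk_eq_zero] at hz
  refine add_mem (Ideal.mul_mem_left _ _ ⟨q, ?_⟩) (Ideal.le_radical (hmem _ hz))
  rw [root_pow_eq]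
  exact add_mem (Ideal.mul_mem_right _ _ (hmem _ (dvd_pow hfa (by omega)))) (hmem _ hfb)

theorem isRadical_span_algebraMap [Fintype F] (hcard : Fintype.card F = q)
    {f : F[X]} (hf : Irreducible f) (hfb : f ∣ b) (hfa : ¬ f ∣ a) :
    (Ideal.span {algebraMap F[X] (Aqgen F q a b) f}).IsRadical :=
  isRadical_span_of_pow_eq hcard hf hfb hfa (root_pow_eq a b) fun z => by
    obtain ⟨G, rfl⟩ := AdjoinRoot.mk_surjective z
    exact ⟨G, AdjoinRoot.aeval_eq G⟩

variable [IsDomain (Aqgen F q a b)]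

theorem algebraMap_injective_Aqgen (hq : 1 < q) :
    Function.Injective (algebraMap F[X] (Aqgen F q a b)) :=
  have : Nonempty (Fin q) := ⟨⟨0, by omega⟩⟩
  (powBasis hq a b).algebraMap_injective

theorem infinite_Aqgen (hq : 1 < q) : Infinite (Aqgen F q a b) :=
  Infinite.of_injective _ (algebraMap_injective_Aqgen (a := a) (b := b) hq)

theorem adeg_mul_s13 (hq : 1 < q) {x y : Aqgen F q a b} (hx : x ≠ 0) (hy : y ≠ 0) :
    adeg F (x * y) = adeg F x + adeg F y := by
  simp only [adeg]
  rw [finrank_quotient_span_eq_natDegree_norm (powBasis hq a b) (mul_ne_zero hx hy),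
    finrank_quotient_span_eq_natDegree_norm (powBasis hq a b) hx,
    finrank_quotient_span_eq_natDegree_norm (powBasis hq a b) hy, map_mul, natDegree_mul]
  · exact (Algebra.norm_ne_zero_iff_of_basis (powBasis hq a b)).mpr hx
  · exact (Algebra.norm_ne_zero_iff_of_basis (powBasis hq a b)).mpr hy

theorem adeg_pow_s13 (hq : 1 < q) {x : Aqgen F q a b} (hx : x ≠ 0) (i : ℕ) :
    adeg F (x ^ i) = i * adeg F x := by
  induction i with
  | zero => rw [pow_zero, adeg_one_s13, zero_mul]
  | succ i ih => rw [pow_succ, adeg_mul_s13 hq (pow_ne_zero i hx) hx, ih, Nat.succ_mul]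

theorem adeg_algebraMap (hq : 1 < q) {g : F[X]} (hg : g ≠ 0) :
    adeg F (algebraMap F[X] (Aqgen F q a b) g) = q * g.natDegree := by
  have h0 : algebraMap F[X] (Aqgen F q a b) g ≠ 0 := fun h =>
    hg (algebraMap_injective_Aqgen hq (h.trans (map_zero _).symm))
  rw [adeg, finrank_quotient_span_eq_natDegree_norm (powBasis hq a b) h0,
    Algebra.norm_algebraMap_of_basis (powBasis hq a b), natDegree_pow, Fintype.card_fin]

theorem dvd_adeg_of_adeg_lt (hq : 1 < q) {V : ℕ → Submodule F (Aqgen F q a b)}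
    (hV : ∀ m : ℕ, (V m : Set (Aqgen F q a b)) = {c : Aqgen F q a b | c = 0 ∨ adeg F c ≤ m})
    {N : ℕ} (hN : adeg F (AdjoinRoot.root (X ^ q - C (a ^ (q - 1)) * X - C b)) = N)
    (hNq : Nat.Coprime q N) {c : Aqgen F q a b} (hc : c ≠ 0) (hcN : adeg F c < N) :
    q ∣ adeg F c := by
  let t : Fin q → Aqgen F q a b := fun i =>
    algebraMap F[X] _ ((powBasis hq a b).repr c i) *
      AdjoinRoot.root (X ^ q - C (a ^ (q - 1)) * X - C b) ^ (i : ℕ)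
  have hsum : ∑ i, t i = c := by
    conv_rhs => rw [← (powBasis hq a b).sum_repr c]
    exact Finset.sum_congr rfl fun i _ => by rw [powBasis_apply, Algebra.smul_def]
  have hdeg : ∀ i, t i ≠ 0 →
      adeg F (t i) = q * ((powBasis hq a b).repr c i).natDegree + i * N := by
    intro i hi
    have h1 : (powBasis hq a b).repr c i ≠ 0 := by
      intro h
      exact hi (by simp only [t, h, map_zero, zero_mul])
    rw [adeg_mul_s13 hq (left_ne_zero_of_mul hi) (right_ne_zero_of_mul hi), adeg_algebraMap hq h1,
      adeg_pow_s13 hq (root_ne_zero hq a b), hN]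
  obtain ⟨i, -, hi, hadeg⟩ := exists_adeg_sum_eq hV Finset.univ t (fun i _ j _ hi hj hij => by
    rw [hdeg i hi, hdeg j hj] at hij
    have h1 : (i * N : ℕ) ≡ j * N [MOD q] := by
      have := congrArg (· % q) hij
      simpa [Nat.ModEq] using this
    have h2 : (i : ℕ) ≡ j [MOD q] := Nat.ModEq.cancel_right_of_coprime hNq h1
    exact Fin.ext (by rwa [Nat.ModEq, Nat.mod_eq_of_lt i.2, Nat.mod_eq_of_lt j.2] at h2))
    (by rwa [hsum])
  rw [hsum, hdeg i hi] at hadeg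
  have hi0 : (i : ℕ) = 0 := by
    by_contra h
    have := Nat.le_mul_of_pos_left N (Nat.pos_of_ne_zero h)
    omega
  rw [hadeg, hi0, zero_mul, add_zero]
  exact dvd_mul_right _ _

theorem mulDegreeLT_injective (hq : 1 < q) {g : F[X]} (hg : g ≠ 0) (n : ℕ) :
    Function.Injective (mulDegreeLT q a b g n) :=
  (algebraMap_injective_Aqgen hq).comp
    ((mul_right_injective₀ hg).comp Subtype.coe_injective)

theorem mulDegreeLT_mem (hq : 1 < q) {V : ℕ → Submodule F (Aqgen F q a b)}
    (hV : ∀ m : ℕ, (V m : Set (Aqgen F q a b)) = {c : Aqgen F q a b | c = 0 ∨ adeg F c ≤ m})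
    {g : F[X]} (hg : g ≠ 0) {n m : ℕ} (hm : q * (g.natDegree + n) ≤ m)
    (f : degreeLT F (n + 1)) : mulDegreeLT q a b g (n + 1) f ∈ V m := by
  rw [← SetLike.mem_coe, hV]
  by_cases hf : (f : F[X]) = 0
  · left
    rw [show f = 0 from Subtype.ext hf, map_zero]
  · right
    change adeg F (algebraMap F[X] (Aqgen F q a b) (g * f)) ≤ m
    rw [adeg_algebraMap hq (mul_ne_zero hg hf), natDegree_mul hg hf]
    have h1 : (f : F[X]).natDegree < n + 1 :=
      (natDegree_lt_iff_degree_lt hf).mpr (mem_degreeLT.mp f.2)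
    exact (Nat.mul_le_mul_left q (by omega)).trans hm

theorem lt_finrank_inf (hq : 1 < q) {V : ℕ → Submodule F (Aqgen F q a b)}
    (hV : ∀ m : ℕ, (V m : Set (Aqgen F q a b)) = {c : Aqgen F q a b | c = 0 ∨ adeg F c ≤ m})
    {I : Ideal (Aqgen F q a b)} {g : F[X]} (hg : g ≠ 0)
    (hgI : algebraMap F[X] (Aqgen F q a b) g ∈ I) {n m : ℕ} (hm : q * (g.natDegree + n) ≤ m)
    [Module.Finite F (V m)] :
    n < Module.finrank F (I.restrictScalars F ⊓ V m : Submodule F (Aqgen F q a b)) := by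
  have : Module.Finite F (I.restrictScalars F ⊓ V m : Submodule F (Aqgen F q a b)) :=
    Module.Finite.of_injective _ (Submodule.inclusion_injective inf_le_right)
  have h := LinearMap.finrank_le_finrank_of_injective
    (f := (mulDegreeLT q a b g (n + 1)).codRestrict
      (I.restrictScalars F ⊓ V m : Submodule F (Aqgen F q a b))
      fun f => ⟨?_, mulDegreeLT_mem hq hV hg hm f⟩)
    (fun x y hxy => mulDegreeLT_injective hq hg (n + 1) (congrArg Subtype.val hxy))
  · rwa [finrank_degreeLT] at h
  · change algebraMap F[X] (Aqgen F q a b) (g * f) ∈ I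
    rw [map_mul]
    exact I.mul_mem_right _ hgI

theorem dvd_adeg_of_finrank_eq (hq : 1 < q) {V : ℕ → Submodule F (Aqgen F q a b)}
    (hV : ∀ m : ℕ, (V m : Set (Aqgen F q a b)) = {c : Aqgen F q a b | c = 0 ∨ adeg F c ≤ m})
    {r : ℕ} (hr : Module.finrank F (V (r * q)) = r + 1) {c : Aqgen F q a b} (hc : c ≠ 0)
    (hcr : adeg F c ≤ r * q) : q ∣ adeg F c := by
  have : Module.Finite F (V (r * q)) := Module.finite_of_finrank_pos (by omega)
  have hle : LinearMap.range (mulDegreeLT q a b 1 (r + 1)) ≤ V (r * q) := by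
    rintro _ ⟨f, rfl⟩
    exact mulDegreeLT_mem hq hV one_ne_zero (by rw [natDegree_one, zero_add, mul_comm]) f
  have heq := Submodule.eq_of_le_of_finrank_le hle (by
    rw [hr, LinearMap.finrank_range_of_inj (mulDegreeLT_injective hq one_ne_zero _),
      finrank_degreeLT])
  have hcV : c ∈ V (r * q) := by
    rw [← SetLike.mem_coe, hV]
    exact Or.inr hcr
  rw [← heq] at hcV
  obtain ⟨f, rfl⟩ := hcV
  change q ∣ adeg F (algebraMap F[X] (Aqgen F q a b) (1 * f))
  rw [adeg_algebraMap hq]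
  · exact dvd_mul_right _ _
  · intro h
    refine hc ?_
    change algebraMap F[X] (Aqgen F q a b) (1 * f) = 0
    rw [h, map_zero]

end ArtinSchreier

section ClassGroupExponent

/-- If a power `x ^ j` of an element with `x ^ q = 1`, where `q` is a prime power, has order `k ≠ 1`
and `j * k = q`, then `x` has order `q`. -/
theorem orderOf_eq_of_orderOf_pow_eq {G : Type*} [Group G] {p n q j k : ℕ} (hp : p.Prime)
    (hq : q = p ^ n) {x : G} (hx : x ^ q = 1) (hk : orderOf (x ^ j) = k) (hk1 : k ≠ 1)
    (hjk : j * k = q) : orderOf x = q := by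
  subst hq
  obtain ⟨m, -, hm⟩ := (Nat.dvd_prime_pow hp).mp (orderOf_dvd_of_pow_eq_one hx)
  obtain ⟨i, -, rfl⟩ := (Nat.dvd_prime_pow hp).mp ⟨k, hjk.symm⟩
  rcases le_total m i with h | h
  · refine absurd hk.symm ?_
    rwa [orderOf_eq_one_iff.mpr (orderOf_dvd_iff_pow_eq_one.mp (hm ▸ pow_dvd_pow p h))]
  · have h1 : p ^ i ∣ orderOf x := hm ▸ pow_dvd_pow p h
    rw [orderOf_pow_of_dvd (pow_ne_zero i hp.ne_zero) h1] at hk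
    rw [← hjk, ← hk, Nat.mul_div_cancel' h1]

theorem exponent_eq_one_or_eq {G : Type*} [Group G] {q : ℕ}
    (h : ∀ x : G, x ≠ 1 → orderOf x ∣ q ∧ ∃ y : G, orderOf y = q) :
    Monoid.exponent G = 1 ∨ Monoid.exponent G = q := by
  rcases subsingleton_or_nontrivial G with hG | hG
  · exact Or.inl (Monoid.exp_eq_one_iff.mpr hG)
  · obtain ⟨x, hx⟩ := exists_ne (1 : G)
    obtain ⟨y, hy⟩ := (h x hx).2
    refine Or.inr (Nat.dvd_antisymm (Monoid.exponent_dvd_of_forall_pow_eq_one fun z => ?_)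
      (hy ▸ Monoid.order_dvd_exponent y))
    by_cases hz : z = 1
    · rw [hz, one_pow]
    · exact orderOf_dvd_iff_pow_eq_one.mp (h z hz).1

theorem lq_mul_self {q : ℕ} (hq : 1 < q) (m : ℕ) : lq q (q * m) = lq q m := by
  rcases Nat.eq_zero_or_pos m with rfl | hm
  · rw [mul_zero]
  · rw [lq, lq, Nat.digits_base_mul hq hm, List.sum_cons, zero_add]

variable {F : Type*} [Field F] [Fintype F] {q : ℕ} {a b : F[X]} [IsDedekindDomain (Aqgen F q a b)]

/-- An irreducible common divisor of `a` and `b` is totally ramified in `A`. -/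
theorem exists_pow_eq_span_algebraMap
    (hfin : ∀ I : Ideal (Aqgen F q a b), I ≠ ⊥ → Module.Finite F (Aqgen F q a b ⧸ I)) (hq : 1 < q)
    {f : F[X]} (hf : Irreducible f) (hfa : f ∣ a) (hfb : f ∣ b) :
    ∃ P : Ideal (Aqgen F q a b), P.IsPrime ∧ P ≠ ⊥ ∧
      P ^ q = Ideal.span {algebraMap F[X] (Aqgen F q a b) f} := by
  have : Fact (Irreducible f) := ⟨hf⟩
  have := infinite_Aqgen (a := a) (b := b) hq
  have hf0 : algebraMap F[X] (Aqgen F q a b) f ≠ 0 := fun h =>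
    hf.ne_zero (algebraMap_injective_Aqgen hq (h.trans (map_zero _).symm))
  set P := RingHom.ker (reduction hq a hfb) with hP
  have hPp : P.IsPrime := RingHom.ker_isPrime _
  have hfP : algebraMap F[X] (Aqgen F q a b) f ∈ P := by
    rw [hP, RingHom.mem_ker, reduction_algebraMap, AdjoinRoot.mk_self]
  have hP0 : P ≠ ⊥ := fun h => hf0 (by rwa [h, Ideal.mem_bot] at hfP)
  refine ⟨P, hPp, hP0, ?_⟩
  obtain ⟨j, hj⟩ := Ideal.exists_pow_le_of_le_radical_of_fg
    (ker_reduction_le_radical hq hfa hfb) (IsNoetherian.noetherian P)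
  obtain ⟨i, -, hi⟩ := (dvd_prime_pow (Ideal.prime_of_isPrime hP0 hPp) j).mp
    (Ideal.dvd_iff_le.mpr hj)
  rw [associated_iff_eq] at hi
  have hdeg := adeg_algebraMap (a := a) (b := b) hq hf.ne_zero
  change idealDeg F (Ideal.span {_}) = _ at hdeg
  rw [hi, idealDeg_pow hfin hP0, idealDeg_ker_reduction hq hf.ne_zero hfb] at hdeg
  rw [hi, Nat.eq_of_mul_eq_mul_right hf.natDegree_pos hdeg]

/-- A class of order `k` whose `k`-th power is generated by an irreducible divisor of `b` is a
power of a class of order `q`. -/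
theorem exists_orderOf_eq {p n : ℕ} (hp : p.Prime) (hqp : q = p ^ n) (hcard : Fintype.card F = q)
    (hfin : ∀ I : Ideal (Aqgen F q a b), I ≠ ⊥ → Module.Finite F (Aqgen F q a b ⧸ I))
    {I : (Ideal (Aqgen F q a b))⁰} {k : ℕ} (hI1 : ClassGroup.mk0 I ≠ 1)
    (hk : orderOf (ClassGroup.mk0 I) = k)
    {f : F[X]} (hf : Irreducible f) (hfb : f ∣ b)
    (hIf : (I : Ideal (Aqgen F q a b)) ^ k = Ideal.span {algebraMap F[X] (Aqgen F q a b) f}) :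
    k ∣ q ∧ ∃ κ : ClassGroup (Aqgen F q a b), orderOf κ = q := by
  have hq : 1 < q := hcard ▸ Fintype.one_lt_card
  have hf1 : Ideal.span {algebraMap F[X] (Aqgen F q a b) f} ≠ ⊤ := by
    intro h
    have h1 := adeg_algebraMap (a := a) (b := b) hq hf.ne_zero
    rw [adeg, h, Module.finrank_zero_of_subsingleton] at h1
    exact (Nat.mul_pos (by omega) hf.natDegree_pos).ne h1
  have hk0 : k ≠ 0 := by
    rintro rfl
    rw [pow_zero, Ideal.one_eq_top] at hIf
    exact hf1 hIf.symm
  have hfa : f ∣ a := by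
    by_contra hfa
    have hrad := isRadical_span_algebraMap hcard hf hfb hfa
    have hle : (I : Ideal (Aqgen F q a b)) ≤ Ideal.span {algebraMap F[X] (Aqgen F q a b) f} :=
      fun z hz => hrad ⟨k, hIf ▸ Ideal.pow_mem_pow hz k⟩
    have heq := le_antisymm hle (hIf ▸ Ideal.pow_le_self hk0)
    exact hI1 ((ClassGroup.mk0_eq_one_iff I.2).mpr ⟨_, heq⟩)
  obtain ⟨P, hPp, hP0, hPq⟩ := exists_pow_eq_span_algebraMap hfin hq hf hfa hfb
  obtain ⟨j, -, hj⟩ := (dvd_prime_pow (Ideal.prime_of_isPrime hP0 hPp) q).mp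
    (hPq ▸ hIf ▸ dvd_pow_self (I : Ideal (Aqgen F q a b)) hk0)
  rw [associated_iff_eq] at hj
  have hjk : j * k = q := by
    rw [hj, ← hPq, ← pow_mul] at hIf
    exact (Ideal.pow_right_strictAnti P hP0 hPp.ne_top).injective hIf
  let P' : (Ideal (Aqgen F q a b))⁰ := ⟨P, mem_nonZeroDivisors_of_ne_zero hP0⟩
  have hIP : ClassGroup.mk0 I = ClassGroup.mk0 P' ^ j := by
    rw [← map_pow]
    exact congrArg _ (Subtype.ext hj)
  have hP1 : ClassGroup.mk0 P' ^ q = 1 := by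
    rw [← map_pow]
    exact (ClassGroup.mk0_eq_one_iff (P' ^ q).2).mpr ⟨_, hPq⟩
  refine ⟨⟨j, by rw [mul_comm, hjk]⟩, ClassGroup.mk0 P', ?_⟩
  have hk1 : k ≠ 1 := fun h => hI1 (orderOf_eq_one_iff.mp (hk.trans h))
  rw [hIP] at hk
  exact orderOf_eq_of_orderOf_pow_eq hp hqp hP1 hk hk1 hjk

end ClassGroupExponent

/-- main theorem of the paper.  Let `q = pⁿ`, let
`A = F_q[x][y]/(y^q − a(x)^{q−1}y − b(x))` be a Dedekind domain with unit group `F_q^×`,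
`deg y = N > q·deg a` prime to `p`, negative `m`-adic valuations of `u = b/a^q` prime to
`p`, an `r`-gap structure at `∞` with `r ≥ q − 1`, class number `h` and class group exponent
`e`, finitely many ideals of each degree, and ideals `I_1, …, I_{h−1}` representing all
nontrivial classes with `deg I_k = d_k`, class order `e_k`, `I_k^{e_k} = (f_k)`, `f_k`
irreducible in `F_q[x]` dividing `b`.  If `N > qμ + e_k d_k` for all `k`, then for every
positive multiple `s` of `q − 1` with `l_q(es) ≤ μ(q−1)` and `l_q(es) ≤ r(q−1)`, the ideal
zeta polynomial `Z(X) = ∑_d X^d ∑_{deg I = d} c(I)^{es}` is independent of the choice of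
generators `c(I)` of `I^e`, has finitely many nonzero coefficients, and is divisible by
`(X − 1)^q`; i.e. `ζ(−es)` has multiplicity at least `q`. -/
theorem statement13 (F : Type*) [Field F] [Fintype F] (p n q : ℕ) (hp : p.Prime)
    (hn : 1 ≤ n) (hq : q = p ^ n) (hcard : Fintype.card F = q)
    (a b : F[X]) (ha : a ≠ 0)
    [IsDedekindDomain (Aqgen F q a b)]
    (hunit : ∀ u : (Aqgen F q a b)ˣ,
      ∃ t : F, t ≠ 0 ∧ (u : Aqgen F q a b) = algebraMap F (Aqgen F q a b) t)
    (hunit' : ∀ t : F, t ≠ 0 → IsUnit (algebraMap F (Aqgen F q a b) t))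
    (N : ℕ) (hN : adeg F (AdjoinRoot.root (X ^ q - C (a ^ (q - 1)) * X - C b)) = N)
    (hNa : q * a.natDegree < N) (hNp : Nat.Coprime N p)
    (hu : ∀ m : F[X], Irreducible m → ∀ (v : ℤ) (z₁ z₂ : F[X]), z₂ ≠ 0 →
      ¬ m ∣ z₁ → ¬ m ∣ z₂ →
      algebraMap F[X] (RatFunc F) b / (algebraMap F[X] (RatFunc F) a) ^ q =
        (algebraMap F[X] (RatFunc F) m) ^ v *
          (algebraMap F[X] (RatFunc F) z₁ / algebraMap F[X] (RatFunc F) z₂) →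
      v < 0 → ¬ ((p : ℤ) ∣ v))
    (hdegfin : ∀ c : Aqgen F q a b, c ≠ 0 →
      Module.Finite F (Aqgen F q a b ⧸ Ideal.span {c}))
    (V : ℕ → Submodule F (Aqgen F q a b))
    (hV : ∀ m : ℕ, (V m : Set (Aqgen F q a b)) = {c : Aqgen F q a b | c = 0 ∨ adeg F c ≤ m})
    (hVdim : ∀ m : ℕ, Module.finrank F (V m) =
      1 + Set.ncard {j : ℕ | 1 ≤ j ∧ j ≤ m ∧ ¬ IsGapA F (Aqgen F q a b) j})
    (g : ℕ) (hgfin : {m : ℕ | 1 ≤ m ∧ IsGapA F (Aqgen F q a b) m}.Finite)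
    (hg : {m : ℕ | 1 ≤ m ∧ IsGapA F (Aqgen F q a b) m}.ncard = g)
    (r : ℕ) (hr : q - 1 ≤ r)
    (hgap1 : ∀ i : ℕ, 1 ≤ i → i ≤ r → Module.finrank F (V (i * q)) = i + 1)
    (hgap2 : Module.finrank F (V (g + r)) = r + 1)
    (hgap3 : r * q ≤ g + r)
    (h e : ℕ) (hpos : 0 < h) (hh : Nat.card (ClassGroup (Aqgen F q a b)) = h)
    (he : Monoid.exponent (ClassGroup (Aqgen F q a b)) = e)
    (hIfin : ∀ d : ℕ, {I : Ideal (Aqgen F q a b) | I ≠ ⊥ ∧ idealDeg F I = d}.Finite)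
    (I : Fin (h - 1) → (Ideal (Aqgen F q a b))⁰)
    (hInontriv : ∀ k, ClassGroup.mk0 (I k) ≠ 1)
    (hIrep : ∀ C : ClassGroup (Aqgen F q a b), C ≠ 1 → ∃! k, ClassGroup.mk0 (I k) = C)
    (dk ek : Fin (h - 1) → ℕ)
    (hdk : ∀ k, idealDeg F (I k : Ideal (Aqgen F q a b)) = dk k)
    (hek : ∀ k, orderOf (ClassGroup.mk0 (I k)) = ek k)
    (f : Fin (h - 1) → F[X])
    (hfirr : ∀ k, Irreducible (f k)) (hfb : ∀ k, f k ∣ b)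
    (hfgen : ∀ k, (I k : Ideal (Aqgen F q a b)) ^ ek k =
      Ideal.span {algebraMap F[X] (Aqgen F q a b) (f k)})
    (μ : ℕ) (hμ : 1 ≤ μ) (hNμ : ∀ k, q * μ + ek k * dk k < N)
    (s : ℕ) (hs : 1 ≤ s) (hsdvd : (q - 1) ∣ s)
    (hls : lq q (e * s) ≤ μ * (q - 1)) (hls' : lq q (e * s) ≤ r * (q - 1)) :
    (∀ c : Ideal (Aqgen F q a b) → Aqgen F q a b,
        (∀ J : Ideal (Aqgen F q a b), J ≠ ⊥ → Ideal.span {c J} = J ^ e) →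
        {d : ℕ | idealZetaCoeff F c (e * s) d ≠ 0}.Finite ∧
          (X - 1 : Polynomial (Aqgen F q a b)) ^ q ∣ idealZeta F (Aqgen F q a b) c (e * s)) ∧
      ∀ c c' : Ideal (Aqgen F q a b) → Aqgen F q a b,
        (∀ J : Ideal (Aqgen F q a b), J ≠ ⊥ → Ideal.span {c J} = J ^ e) →
        (∀ J : Ideal (Aqgen F q a b), J ≠ ⊥ → Ideal.span {c' J} = J ^ e) →
        idealZeta F (Aqgen F q a b) c (e * s) = idealZeta F (Aqgen F q a b) c' (e * s) := by
  have hq1 : 1 < q := hcard ▸ Fintype.one_lt_card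
  have := infinite_Aqgen (a := a) (b := b) hq1
  have : Finite (ClassGroup (Aqgen F q a b)) := Nat.finite_of_card_ne_zero (by omega)
  have hfin : ∀ I : Ideal (Aqgen F q a b), I ≠ ⊥ → Module.Finite F (Aqgen F q a b ⧸ I) := by
    intro I hI
    obtain ⟨c, hcI, hc0⟩ := Submodule.exists_mem_ne_zero_of_ne_bot hI
    have := hdegfin c hc0
    have hle : Ideal.span {c} ≤ I := (Ideal.span_singleton_le_iff_mem I).mpr hcI
    exact Module.Finite.of_surjective (Ideal.Quotient.factorₐ F hle).toLinearMap
      (Ideal.Quotient.factor_surjective hle)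
  have hVfg : ∀ m, Module.Finite F (V m) := fun m =>
    Module.finite_of_finrank_pos (by rw [hVdim]; omega)
  have hVfin : ∀ m, Finite (V m) := fun m => Module.finite_of_finite F
  have he0 : e ≠ 0 := he ▸ Monoid.exponent_ne_zero_of_finite
  have hdvd : (Fintype.card F - 1) ∣ e * s := hcard ▸ hsdvd.mul_left e
  have hqN : Nat.Coprime q N := hq ▸ (hNp.symm.pow_left n)
  have horder : ∀ κ : ClassGroup (Aqgen F q a b), κ ≠ 1 →
      orderOf κ ∣ q ∧ ∃ κ' : ClassGroup (Aqgen F q a b), orderOf κ' = q := by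
    intro κ hκ
    obtain ⟨k, rfl, -⟩ := hIrep κ hκ
    rw [hek]
    exact exists_orderOf_eq hp hq hcard hfin hκ (hek k) (hfirr k) (hfb k) (hfgen k)
  have hlq : lq q (e * (e * s)) = lq q (e * s) := by
    rcases exponent_eq_one_or_eq horder with h1 | h1
    · rw [← he, h1, one_mul]
    · rw [← he, h1, lq_mul_self hq1]
  have hclass : ∀ κ : ClassGroup (Aqgen F q a b), ∃ I : (Ideal (Aqgen F q a b))⁰,
      ClassGroup.mk0 I = κ ∧ ∃ m : ℕ,
      (∀ α ∈ (I : Ideal (Aqgen F q a b)), α ≠ 0 → adeg F α ≤ m →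
        Fintype.card F ∣ adeg F α) ∧
      lq (Fintype.card F) (e * (e * s)) < (Fintype.card F - 1) * Module.finrank F
        ((I : Ideal (Aqgen F q a b)).restrictScalars F ⊓ V m :
          Submodule F (Aqgen F q a b)) := by
    intro κ
    rw [hcard, hlq]
    by_cases hκ : κ = 1
    · refine ⟨1, by rw [hκ, map_one], r * q, fun α _ hα0 hα =>
        dvd_adeg_of_finrank_eq hq1 hV (hgap1 r (by omega) le_rfl) hα0 hα, ?_⟩
      have h1 := lt_finrank_inf hq1 hV (I := ((1 : (Ideal (Aqgen F q a b))⁰) : Ideal _))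
        one_ne_zero (by rw [OneMemClass.coe_one, Ideal.one_eq_top]; exact Submodule.mem_top)
        (n := r) (m := r * q) (by rw [natDegree_one, zero_add, mul_comm])
      rw [mul_comm r] at hls'
      exact hls'.trans_lt (Nat.mul_lt_mul_of_le_of_lt le_rfl h1 (by omega))
    · obtain ⟨k, rfl, -⟩ := hIrep κ hκ
      have hek0 : ek k ≠ 0 := hek k ▸ (orderOf_pos _).ne'
      have hdeg : ek k * dk k = q * (f k).natDegree := by
        rw [← adeg_algebraMap (a := a) (b := b) hq1 (hfirr k).ne_zero, adeg, ← hfgen, ← hdk,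
          ← idealDeg_pow hfin (nonZeroDivisors.coe_ne_zero (I k)), idealDeg]
      refine ⟨I k, rfl, q * μ + ek k * dk k, fun α _ hα0 hα =>
        dvd_adeg_of_adeg_lt hq1 hV hN hqN hα0 (hα.trans_lt (hNμ k)), ?_⟩
      have h1 := lt_finrank_inf hq1 hV (hfirr k).ne_zero (Ideal.pow_le_self hek0
        (hfgen k ▸ Ideal.mem_span_singleton_self _)) (n := μ) (m := q * μ + ek k * dk k)
        (by rw [hdeg, mul_add, add_comm])
      rw [mul_comm μ] at hls
      exact hls.trans_lt (Nat.mul_lt_mul_of_le_of_lt le_rfl h1 (by omega))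
  refine ⟨fun c hc => ?_, fun c c' hc hc' => idealZeta_congr fun J hJ =>
    pow_eq_of_span_eq hunit hdvd ((hc J hJ).trans (hc' J hJ).symm)⟩
  obtain ⟨h1, h2⟩ := X_pow_card_sub_one_dvd_idealZeta hfin hunit hVfin hV hIfin he
    (mul_ne_zero he0 (by omega)) hdvd hclass hc
  rw [← sub_one_pow_card, hcard] at h2
  exact ⟨h1, h2⟩
end

section
/- Let A := F_2[x][y]/(y² + (x²+x+1)y + (x²+x+1)(x⁵+x²+1)), and for nonzero a ∈ A let deg a := dim_{F_2}(A/aA). For all integers l, m, n ≥ 0 (not necessarily distinct), setting s := 2^l + 2^m + 2^n, the polynomial Z_s(X) := ∑_{d≥0} (∑_{a ∈ A∖{0}, deg a = d} a^s) X^d ∈ A[X] (all but finitely many inner sums vanish) has a zero at X = 1 of order exactly 2; i.e., the order of vanishing of the zeta function of A at −s is 2. -/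
open Polynomial

/-- The coordinate ring `A = F_2[x][y]/(y² + (x²+x+1)y + (x²+x+1)(x⁵+x²+1))` of a
hyperelliptic curve of genus `3` over `F_2`. -/
noncomputable abbrev A18 : Type :=
  AdjoinRoot (X ^ 2 + C ((X : Polynomial (ZMod 2)) ^ 2 + X + 1) * X +
      C (((X : Polynomial (ZMod 2)) ^ 2 + X + 1) *
        ((X : Polynomial (ZMod 2)) ^ 5 + (X : Polynomial (ZMod 2)) ^ 2 + 1)) :
    (Polynomial (ZMod 2))[X])

section QuadraticExtension

variable {F : Type*} [Field F] (B D : F[X])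

/-- The quadratic extension `F[x][y]/(y² + B y + D)` of `F[x]`. -/
abbrev QuadRing : Type _ :=
  AdjoinRoot (X ^ 2 + C B * X + C D : F[X][X])

namespace QuadRing

lemma natDegree_poly : (X ^ 2 + C B * X + C D : F[X][X]).natDegree = 2 := by
  compute_degree!

lemma monic_poly : (X ^ 2 + C B * X + C D : F[X][X]).Monic := by
  monicity!

/-- The basis `1, y` of `F[x][y]/(y² + B y + D)` over `F[x]`. -/
noncomputable def basis : Module.Basis (Fin 2) F[X] (QuadRing B D) :=
  (AdjoinRoot.powerBasis' (monic_poly B D)).basis.reindex (finCongr (natDegree_poly B D))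

lemma basis_apply (i : Fin 2) : basis B D i = AdjoinRoot.root _ ^ (i : ℕ) := by
  rw [basis, Module.Basis.reindex_apply, PowerBasis.basis_eq_pow, AdjoinRoot.powerBasis'_gen]
  rfl

lemma basis_zero : basis B D 0 = 1 := by
  rw [basis_apply, Fin.val_zero, pow_zero]

lemma basis_one : basis B D 1 = AdjoinRoot.root _ := by
  rw [basis_apply, Fin.val_one, pow_one]

/-- The element `u + v y` of `F[x][y]/(y² + B y + D)`. -/
noncomputable def elt (u v : F[X]) : QuadRing B D :=
  u • basis B D 0 + v • basis B D 1

lemma exists_elt_eq (a : QuadRing B D) : ∃ u v, elt B D u v = a := by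
  have h := (basis B D).sum_repr a
  rw [Fin.sum_univ_two] at h
  exact ⟨_, _, h⟩

lemma elt_add_elt (u v u' v' : F[X]) :
    elt B D u v + elt B D u' v' = elt B D (u + u') (v + v') := by
  simp only [elt, add_smul]
  abel

lemma elt_zero_right (u : F[X]) : elt B D u 0 = AdjoinRoot.of _ u := by
  rw [elt, zero_smul, add_zero, basis_zero, Algebra.smul_def, mul_one]
  rfl

lemma elt_eq_zero_iff {u v : F[X]} : elt B D u v = 0 ↔ u = 0 ∧ v = 0 := by
  refine ⟨fun h => ?_, fun ⟨hu, hv⟩ => by simp [elt, hu, hv]⟩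
  have h' := Fintype.linearIndependent_iff.1 (basis B D).linearIndependent ![u, v]
    (by simpa [Fin.sum_univ_two, elt] using h)
  exact ⟨h' 0, h' 1⟩

lemma of_injective :
    Function.Injective (AdjoinRoot.of (X ^ 2 + C B * X + C D : F[X][X])) := by
  rw [injective_iff_map_eq_zero]
  intro u hu
  rw [← elt_zero_right] at hu
  exact ((elt_eq_zero_iff B D).1 hu).1

lemma root_mul_root :
    basis B D 1 * basis B D 1 = (-D) • basis B D 0 + (-B) • basis B D 1 := by
  have h := AdjoinRoot.eval₂_root (X ^ 2 + C B * X + C D : F[X][X])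
  simp only [eval₂_add, eval₂_mul, eval₂_C, eval₂_pow, eval₂_X] at h
  simp only [basis_zero, basis_one, Algebra.smul_def, map_neg, AdjoinRoot.algebraMap_eq]
  linear_combination h

lemma norm_elt (u v : F[X]) :
    Algebra.norm F[X] (elt B D u v) = u ^ 2 - u * v * B + v ^ 2 * D := by
  have h1 : elt B D u v * basis B D 1 =
      (-(v * D)) • basis B D 0 + (u - v * B) • basis B D 1 := by
    rw [elt, add_mul, smul_mul_assoc, smul_mul_assoc, root_mul_root, basis_zero, one_mul]
    module
  have h0 : elt B D u v * basis B D 0 = u • basis B D 0 + v • basis B D 1 := by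
    rw [basis_zero, mul_one, elt, basis_zero]
  rw [Algebra.norm_eq_matrix_det (basis B D), Matrix.det_fin_two]
  simp only [Algebra.leftMulMatrix_eq_repr_mul, h0, h1, map_add, map_smul, Finsupp.add_apply,
    Finsupp.smul_apply, Module.Basis.repr_self_apply, smul_eq_mul]
  simp
  ring

variable {B D} {g : ℕ} (hB : B.natDegree ≤ g) (hD : D.natDegree = 2 * g + 1)
include hB hD

lemma natDegree_norm_elt {u v : F[X]} (hv : v ≠ 0) :
    (Algebra.norm F[X] (elt B D u v)).natDegree =
      max (2 * u.natDegree) (2 * v.natDegree + (2 * g + 1)) := by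
  have hD0 : D ≠ 0 := by
    rintro rfl
    simp at hD
  have h1 : (v ^ 2 * D).natDegree = 2 * v.natDegree + (2 * g + 1) := by
    rw [natDegree_mul (pow_ne_zero 2 hv) hD0, natDegree_pow, hD]
  have h2 : (u * v * B).natDegree ≤ u.natDegree + v.natDegree + g :=
    natDegree_mul_le.trans (add_le_add natDegree_mul_le hB)
  have h3 : (u ^ 2).natDegree = 2 * u.natDegree := natDegree_pow u 2
  rw [norm_elt]
  rcases lt_or_ge (v.natDegree + g) u.natDegree with h | h
  · rw [sub_add, natDegree_sub_eq_left_of_natDegree_lt, h3]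
    · omega
    · refine (natDegree_sub_le _ _).trans_lt ?_
      omega
  · rw [natDegree_add_eq_right_of_natDegree_lt, h1]
    · omega
    · refine (natDegree_sub_le _ _).trans_lt ?_
      omega

lemma norm_ne_zero {a : QuadRing B D} (ha : a ≠ 0) : Algebra.norm F[X] a ≠ 0 := by
  obtain ⟨u, v, rfl⟩ := exists_elt_eq B D a
  by_cases hv : v = 0
  · subst hv
    have hu : u ≠ 0 := fun hu => ha ((elt_eq_zero_iff B D).2 ⟨hu, rfl⟩)
    simpa [norm_elt] using hu
  · intro h
    have := natDegree_norm_elt hB hD (u := u) hv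
    rw [h, natDegree_zero] at this
    omega

lemma isDomain : IsDomain (QuadRing B D) := by
  have : Nontrivial (QuadRing B D) := (QuadRing.of_injective B D).nontrivial
  have : NoZeroDivisors (QuadRing B D) := by
    refine ⟨fun {a b} hab => ?_⟩
    by_contra! h
    refine mul_ne_zero (norm_ne_zero hB hD h.1) (norm_ne_zero hB hD h.2) ?_
    have : Module.Free F[X] (QuadRing B D) := .of_basis (basis B D)
    have : Module.Finite F[X] (QuadRing B D) := .of_basis (basis B D)
    rw [← map_mul, hab, Algebra.norm_zero]
  exact NoZeroDivisors.to_isDomain _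

lemma adeg_eq {a : QuadRing B D} (ha : a ≠ 0) :
    adeg F a = (Algebra.norm F[X] a).natDegree :=
  have := isDomain hB hD
  finrank_quotient_span_eq_natDegree_norm (basis B D) ha

lemma adeg_elt {u v : F[X]} (hv : v ≠ 0) :
    adeg F (elt B D u v) = max (2 * u.natDegree) (2 * v.natDegree + (2 * g + 1)) := by
  rw [adeg_eq hB hD (fun h => hv ((elt_eq_zero_iff B D).1 h).2), natDegree_norm_elt hB hD hv]

lemma adeg_of {u : F[X]} (hu : u ≠ 0) :
    adeg F (AdjoinRoot.of _ u : QuadRing B D) = 2 * u.natDegree := by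
  rw [← elt_zero_right, adeg_eq hB hD (fun h => hu ((elt_eq_zero_iff B D).1 h).1), norm_elt]
  simp

/-- Below degree `2g + 1`, the elements of `F[x][y]/(y² + B y + D)` are polynomials in `x`. -/
lemma setOf_adeg_eq_of_lt {d : ℕ} (hd : d < 2 * g + 1) :
    {a : QuadRing B D | a ≠ 0 ∧ adeg F a = d} =
      AdjoinRoot.of _ '' {u : F[X] | u ≠ 0 ∧ 2 * u.natDegree = d} := by
  ext a
  constructor
  · rintro ⟨ha, had⟩
    obtain ⟨u, v, rfl⟩ := exists_elt_eq B D a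
    by_cases hv : v = 0
    · subst hv
      have hu : u ≠ 0 := fun hu => ha ((elt_eq_zero_iff B D).2 ⟨hu, rfl⟩)
      rw [elt_zero_right] at had ⊢
      exact ⟨u, ⟨hu, by rw [← had, adeg_of hB hD hu]⟩, rfl⟩
    · rw [adeg_elt hB hD hv] at had
      omega
  · rintro ⟨u, ⟨hu, hud⟩, rfl⟩
    refine ⟨?_, by rw [adeg_of hB hD hu, hud]⟩
    rw [← elt_zero_right]
    exact fun h => hu ((elt_eq_zero_iff B D).1 h).1

/-- From degree `2g + 1` on, adding a polynomial in `x` of degree at most `g` does not change the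
degree. -/
lemma adeg_add_of {a : QuadRing B D} (ha : a ≠ 0) (had : 2 * g + 1 ≤ adeg F a) {w : F[X]}
    (hw : w.natDegree ≤ g) :
    a + AdjoinRoot.of _ w ≠ 0 ∧ adeg F (a + AdjoinRoot.of _ w) = adeg F a := by
  obtain ⟨u, v, rfl⟩ := exists_elt_eq B D a
  have key : g < u.natDegree → (u + w).natDegree = u.natDegree := fun h =>
    natDegree_add_eq_left_of_natDegree_lt (by omega)
  have key' : (u + w).natDegree ≤ max u.natDegree g :=
    (natDegree_add_le _ _).trans (max_le_max le_rfl hw)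
  by_cases hv : v = 0
  · subst hv
    have hu : u ≠ 0 := fun hu => ha ((elt_eq_zero_iff B D).2 ⟨hu, rfl⟩)
    rw [elt_zero_right, adeg_of hB hD hu] at had
    have huw : u + w ≠ 0 := by
      intro h
      have := key (by omega)
      rw [h, natDegree_zero] at this
      omega
    rw [← elt_zero_right, elt_add_elt, add_zero, elt_zero_right, elt_zero_right,
      adeg_of hB hD hu, adeg_of hB hD huw, key (by omega), ← elt_zero_right]
    exact ⟨fun h => huw ((elt_eq_zero_iff B D).1 h).1, rfl⟩
  · rw [← elt_zero_right, elt_add_elt, add_zero]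
    refine ⟨fun h => hv ((elt_eq_zero_iff B D).1 h).2, ?_⟩
    rw [adeg_elt hB hD hv, adeg_elt hB hD hv]
    by_cases h : g < u.natDegree
    · rw [key h]
    · omega

end QuadRing

end QuadraticExtension

/-- The polynomials over `F_2` of degree less than `n`. -/
noncomputable def polysLT (n : ℕ) : Finset (ZMod 2)[X] := by
  classical exact n.rec {0} fun k s => s ∪ s.image (· + X ^ k)

lemma mem_polysLT {n : ℕ} {u : (ZMod 2)[X]} : u ∈ polysLT n ↔ u.degree < n := by
  classical
  induction n generalizing u with
  | zero => simp [polysLT, degree_eq_bot]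
  | succ n ih =>
    have hs : polysLT (n + 1) = polysLT n ∪ (polysLT n).image (· + X ^ n) := by
      simp only [polysLT]
    simp only [hs, Finset.mem_union, Finset.mem_image, ih, degree_lt_iff_coeff_zero]
    constructor
    · rintro (h | ⟨w, hw, rfl⟩) m hm
      · exact h m (by omega)
      · rw [coeff_add, hw m (by omega), coeff_X_pow, if_neg (by omega), add_zero]
    · intro h
      have hc : ∀ c : ZMod 2, c = 0 ∨ c = 1 := by decide
      rcases hc (u.coeff n) with h0 | h1
      · left
        intro m hm
        rcases hm.eq_or_lt with rfl | hm
        exacts [h0, h m hm]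
      · right
        refine ⟨u + X ^ n, fun m hm => ?_, by
          rw [add_assoc, CharTwo.add_self_eq_zero, add_zero]⟩
        rcases hm.eq_or_lt with rfl | hm
        · rw [coeff_add, h1, coeff_X_pow, if_pos rfl, CharTwo.add_self_eq_zero]
        · rw [coeff_add, h m hm, coeff_X_pow, if_neg (by omega), add_zero]

lemma sum_polysLT_zero {M : Type*} [AddCommMonoid M] (f : (ZMod 2)[X] → M) :
    ∑ u ∈ polysLT 0, f u = f 0 := by
  simp [polysLT]

lemma sum_polysLT_succ {M : Type*} [AddCommMonoid M] (n : ℕ) (f : (ZMod 2)[X] → M) :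
    ∑ u ∈ polysLT (n + 1), f u = ∑ u ∈ polysLT n, (f u + f (u + X ^ n)) := by
  classical
  have hs : polysLT (n + 1) = polysLT n ∪ (polysLT n).image (· + X ^ n) := by
    simp only [polysLT]
  rw [hs, Finset.sum_union, Finset.sum_image, Finset.sum_add_distrib]
  · intro a _ b _ h
    simpa using h
  · rw [Finset.disjoint_left]
    intro a ha hb
    obtain ⟨b, hb', rfl⟩ := Finset.mem_image.1 hb
    rw [mem_polysLT, degree_lt_iff_coeff_zero] at ha hb'
    have := ha n le_rfl
    rw [coeff_add, hb' n le_rfl, coeff_X_pow, if_pos rfl, zero_add] at this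
    exact one_ne_zero this

section PowerSums

variable {R : Type*} [CommRing R] [CharP R 2]

/-- A product of three ring homomorphisms sums to zero over a coset of a four-dimensional space. -/
lemma sum_polysLT_four_mul_mul (p q r : R →+* R) (φ : (ZMod 2)[X] →+* R) (a : R) :
    ∑ u ∈ polysLT 4, p (a + φ u) * q (a + φ u) * r (a + φ u) = 0 := by
  simp only [sum_polysLT_succ, sum_polysLT_zero, zero_add, map_add, map_zero]
  grind

lemma sum_polysLT_four_pow (l m n : ℕ) (φ : (ZMod 2)[X] →+* R) (a : R) :
    ∑ u ∈ polysLT 4, (a + φ u) ^ (2 ^ l + 2 ^ m + 2 ^ n) = 0 := by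
  rw [← sum_polysLT_four_mul_mul (iterateFrobenius R 2 l) (iterateFrobenius R 2 m)
    (iterateFrobenius R 2 n) φ a]
  simp only [iterateFrobenius_def, pow_add]

/-- Sums over a finite set stable under translation by a four-dimensional space vanish. -/
lemma sum_pow_eq_zero_of_stable (l m n : ℕ) {φ : (ZMod 2)[X] →+* R} (hφ : Function.Injective φ)
    {s : Finset R} (hs : ∀ a ∈ s, ∀ u ∈ polysLT 4, a + φ u ∈ s) :
    ∑ a ∈ s, a ^ (2 ^ l + 2 ^ m + 2 ^ n) = 0 := by
  classical
  let V := (degreeLT (ZMod 2) 4).toAddSubgroup.map φ.toAddMonoidHom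
  refine Finset.sum_cancels_of_partition_cancels (QuotientAddGroup.leftRel V) fun a ha => ?_
  have hfib : {b ∈ s | QuotientAddGroup.leftRel V b a} =
      (polysLT 4).image fun u => a + φ u := by
    ext b
    rw [Finset.mem_filter, Finset.mem_image, Setoid.comm', QuotientAddGroup.leftRel_apply]
    constructor
    · rintro ⟨-, u, hu, hub⟩
      refine ⟨u, mem_polysLT.2 (mem_degreeLT.1 hu), ?_⟩
      change φ u = _ at hub
      rw [hub, add_neg_cancel_left]
    · rintro ⟨u, hu, rfl⟩
      refine ⟨hs a ha u hu, u, mem_degreeLT.2 (mem_polysLT.1 hu), ?_⟩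
      change φ u = _
      rw [neg_add_cancel_left]
  rw [hfib, Finset.sum_image fun u _ v _ h => hφ (add_left_cancel h), sum_polysLT_four_pow]

end PowerSums

/-- The sum of the `s`-th powers of the nonzero polynomials over `F_2` of degree `k`, for
`k < 4`. -/
noncomputable def powSum (s k : ℕ) : (ZMod 2)[X] :=
  ∑ u ∈ polysLT 4 with u ≠ 0 ∧ u.natDegree = k, u ^ s

lemma mem_polysLT_four {u : (ZMod 2)[X]} : u ∈ polysLT 4 ↔ u.natDegree < 4 := by
  by_cases hu : u = 0
  · rw [mem_polysLT, hu, degree_zero, natDegree_zero]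
    exact iff_of_true (WithBot.bot_lt_coe 4) four_pos
  · rw [mem_polysLT, natDegree_lt_iff_degree_lt hu]

lemma sum_powSum (l m n : ℕ) :
    ∑ k ∈ Finset.range 4, powSum (2 ^ l + 2 ^ m + 2 ^ n) k = 0 := by
  have h := sum_polysLT_four_pow l m n (RingHom.id (ZMod 2)[X]) 0
  simp only [RingHom.id_apply, zero_add] at h
  rw [← Finset.sum_filter_of_ne (p := fun u => u ≠ 0),
    ← Finset.sum_fiberwise_of_maps_to (t := Finset.range 4) (g := natDegree)] at h
  · simpa only [powSum, Finset.filter_filter] using h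
  · intro u hu
    exact Finset.mem_range.2 (mem_polysLT_four.1 (Finset.mem_filter.1 hu).1)
  · rintro u - hu rfl
    exact hu (zero_pow (Nat.add_pos_right _ (by positivity)).ne')

lemma zmod_two_pow {s : ℕ} (hs : s ≠ 0) (c : ZMod 2) : c ^ s = c := by
  have hc : ∀ c : ZMod 2, c = 0 ∨ c = 1 := by decide
  rcases hc c with rfl | rfl
  exacts [zero_pow hs, one_pow s]

lemma eval_powSum {s : ℕ} (hs : s ≠ 0) (k : ℕ) :
    (powSum s k).eval 0 = ∑ u ∈ polysLT 4 with u ≠ 0 ∧ u.natDegree = k, u.coeff 0 := by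
  rw [powSum, eval_finsetSum]
  refine Finset.sum_congr rfl fun u _ => ?_
  rw [eval_pow, zmod_two_pow hs, coeff_zero_eq_eval_zero]

lemma eval_powSum_one {s : ℕ} (hs : s ≠ 0) : (powSum s 1).eval 0 = 1 := by
  classical
  have h : {u ∈ polysLT 4 | u ≠ 0 ∧ u.natDegree = 1} = {X, X + 1} := by
    ext u
    simp only [Finset.mem_filter, mem_polysLT_four, Finset.mem_insert, Finset.mem_singleton]
    constructor
    · rintro ⟨-, -, hu⟩
      have hc : ∀ c : ZMod 2, c = 0 ∨ c = 1 := by decide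
      obtain ⟨a, b, rfl⟩ := exists_eq_X_add_C_of_natDegree_le_one hu.le
      rcases hc a with rfl | rfl
      · simp at hu
      · rcases hc b with rfl | rfl <;> simp
    · have h1 : (X + 1 : (ZMod 2)[X]).natDegree = 1 := natDegree_X_add_C 1
      rintro (rfl | rfl)
      · simp
      · refine ⟨by omega, fun h => ?_, h1⟩
        simp [h] at h1
  rw [eval_powSum hs, h, Finset.sum_pair (by simp)]
  simp

lemma eval_powSum_three {s : ℕ} (hs : s ≠ 0) : (powSum s 3).eval 0 = 0 := by
  rw [eval_powSum hs]
  have key : ∀ u : (ZMod 2)[X], u.natDegree = 3 → (u + X).natDegree = 3 := fun u hu => by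
    rw [natDegree_add_eq_left_of_natDegree_lt, hu]
    rw [hu, natDegree_X]
    norm_num
  refine Finset.sum_involution (fun u _ => u + X) ?_ ?_ ?_ ?_
  · intro u _
    simp [CharTwo.add_self_eq_zero]
  · intro u _ _ h
    simp at h
  · intro u hu
    rw [Finset.mem_filter, mem_polysLT_four] at hu ⊢
    have := key u hu.2.2
    refine ⟨by omega, fun h => ?_, this⟩
    simp [h] at this
  · intro u _
    rw [add_assoc, CharTwo.add_self_eq_zero, add_zero]

lemma powSum_one_add_powSum_three_ne_zero {s : ℕ} (hs : s ≠ 0) : powSum s 1 + powSum s 3 ≠ 0 := by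
  intro h
  have := congrArg (eval 0) h
  rw [eval_add, eval_powSum_one hs, eval_powSum_three hs, eval_zero, add_zero] at this
  exact one_ne_zero this

section ZetaCoeff

variable {B D : (ZMod 2)[X]} (hB : B.natDegree ≤ 3) (hD : D.natDegree = 7)

include hB hD

lemma zetaCoeff_two_mul (s : ℕ) {k : ℕ} (hk : k < 4) :
    zetaCoeff (ZMod 2) (A := QuadRing B D) s (2 * k) = AdjoinRoot.of _ (powSum s k) := by
  have h : {u : (ZMod 2)[X] | u ≠ 0 ∧ 2 * u.natDegree = 2 * k} =
      ((polysLT 4).filter fun u => u ≠ 0 ∧ u.natDegree = k : Finset (ZMod 2)[X]) := by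
    ext u
    simp only [Set.mem_ofPred_eq, Finset.coe_filter, mem_polysLT_four]
    refine ⟨fun h => ⟨?_, h.1, ?_⟩, fun h => ⟨h.2.1, ?_⟩⟩ <;> omega
  rw [zetaCoeff, QuadRing.setOf_adeg_eq_of_lt hB hD (by omega),
    finsum_mem_image (QuadRing.of_injective B D).injOn, h, finsum_mem_coe_finset, powSum, map_sum]
  simp only [map_pow]

lemma zetaCoeff_odd_of_lt (s : ℕ) {d : ℕ} (hd : d < 7) (hodd : Odd d) :
    zetaCoeff (ZMod 2) (A := QuadRing B D) s d = 0 := by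
  have h : {u : (ZMod 2)[X] | u ≠ 0 ∧ 2 * u.natDegree = d} = ∅ := by
    ext u
    simp only [Set.mem_ofPred_eq, Set.mem_empty_iff_false, iff_false]
    rintro ⟨-, rfl⟩
    exact (Nat.not_odd_iff_even.2 (even_two_mul _)) hodd
  rw [zetaCoeff, QuadRing.setOf_adeg_eq_of_lt hB hD (by omega), h, Set.image_empty,
    finsum_mem_empty]

lemma zetaCoeff_of_seven_le (l m n : ℕ) {d : ℕ} (hd : 7 ≤ d) :
    zetaCoeff (ZMod 2) (A := QuadRing B D) (2 ^ l + 2 ^ m + 2 ^ n) d = 0 := by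
  have := QuadRing.isDomain hB hD
  have : CharP (QuadRing B D) 2 :=
    charP_of_injective_algebraMap (algebraMap (ZMod 2) (QuadRing B D)).injective 2
  by_cases hfin : {a : QuadRing B D | a ≠ 0 ∧ adeg (ZMod 2) a = d}.Finite
  · rw [zetaCoeff, finsum_mem_eq_finite_toFinset_sum _ hfin]
    refine sum_pow_eq_zero_of_stable l m n (QuadRing.of_injective B D) fun a ha u hu => ?_
    rw [Set.Finite.mem_toFinset] at ha ⊢
    obtain ⟨ha, rfl⟩ := ha
    exact QuadRing.adeg_add_of hB hD ha hd (by have := mem_polysLT_four.1 hu; omega)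
  · refine finsum_mem_eq_zero_of_infinite ?_
    rwa [Set.inter_eq_left.2]
    exact fun a ha => pow_ne_zero _ ha.1

lemma support_zetaCoeff_subset (l m n : ℕ) :
    {d : ℕ | zetaCoeff (ZMod 2) (A := QuadRing B D) (2 ^ l + 2 ^ m + 2 ^ n) d ≠ 0} ⊆
      ((Finset.range 4).image (2 * ·) : Finset ℕ) := by
  intro d hd
  have h7 : d < 7 := not_le.1 fun h => hd (zetaCoeff_of_seven_le hB hD l m n h)
  have heven : Even d := Nat.not_odd_iff_even.1 fun h => hd (zetaCoeff_odd_of_lt hB hD _ h7 h)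
  obtain ⟨k, rfl⟩ := heven.two_dvd
  exact Finset.mem_coe.2 (Finset.mem_image.2 ⟨k, Finset.mem_range.2 (by omega), rfl⟩)

lemma zetaPoly_eq_sum (l m n : ℕ) :
    zetaPoly (ZMod 2) (QuadRing B D) (2 ^ l + 2 ^ m + 2 ^ n) =
      ∑ k ∈ Finset.range 4,
        C (AdjoinRoot.of _ (powSum (2 ^ l + 2 ^ m + 2 ^ n) k)) * X ^ (2 * k) := by
  rw [zetaPoly, finsum_eq_sum_of_support_subset (s := (Finset.range 4).image (2 * ·)),
    Finset.sum_image fun a _ b _ h => by simpa using h]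
  · refine Finset.sum_congr rfl fun k hk => ?_
    rw [zetaCoeff_two_mul hB hD _ (Finset.mem_range.1 hk)]
  · refine Set.Subset.trans (fun d hd => ?_) (support_zetaCoeff_subset hB hD l m n)
    intro h
    simp [h] at hd

end ZetaCoeff

lemma rootMultiplicity_X_sub_C_pow_mul {R : Type*} [CommRing R] {a : R} {q : R[X]} (k : ℕ)
    (hq : q.eval a ≠ 0) : rootMultiplicity a ((X - C a) ^ k * q) = k := by
  have hmonic : ((X - C a) ^ k).Monic := (monic_X_sub_C a).pow k
  have h0 : (X - C a) ^ k * q ≠ 0 := fun h => hq (by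
    rw [(hmonic.mul_right_eq_zero_iff).1 h, eval_zero])
  refine le_antisymm (not_lt.1 fun h => ?_) ((le_rootMultiplicity_iff h0).2 (dvd_mul_right _ _))
  obtain ⟨t, ht⟩ := (le_rootMultiplicity_iff h0).1 (Nat.succ_le_of_lt h)
  rw [pow_succ, mul_assoc] at ht
  refine hq ?_
  rw [hmonic.isRegular.left ht]
  simp

lemma rootMultiplicity_one_even_sextic {R : Type*} [CommRing R] [CharP R 2] (c : ℕ → R)
    (hsum : ∑ k ∈ Finset.range 4, c k = 0) (hne : c 1 + c 3 ≠ 0) :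
    rootMultiplicity 1 (∑ k ∈ Finset.range 4, C (c k) * X ^ (2 * k)) = 2 := by
  have h2 : (2 : R[X]) = 0 := CharTwo.two_eq_zero
  have hc := congrArg C hsum
  simp only [Finset.sum_range_succ, Finset.sum_range_zero, zero_add, map_add, map_zero] at hc
  have hfac : ∑ k ∈ Finset.range 4, C (c k) * X ^ (2 * k) =
      (X - C 1) ^ 2 * (C (c 1) + C (c 2) * (1 + X ^ 2) + C (c 3) * (1 + X ^ 2 + X ^ 4)) := by
    simp only [Finset.sum_range_succ, Finset.sum_range_zero, zero_add, C_1]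
    linear_combination hc + ((X - 1) * (C (c 1) + C (c 2) * (1 + X ^ 2) +
      C (c 3) * (1 + X ^ 2 + X ^ 4))) * h2
  rw [hfac]
  refine rootMultiplicity_X_sub_C_pow_mul 2 ?_
  have h2' : (2 : R) = 0 := CharTwo.two_eq_zero
  convert hne using 1
  simp only [eval_add, eval_mul, eval_C, eval_pow, eval_X, eval_one]
  linear_combination (c 2 + c 3) * h2'

/-- For `A = F_2[x][y]/(y² + (x²+x+1)y + (x²+x+1)(x⁵+x²+1))` and
`s = 2^l + 2^m + 2^n` (`l, m, n ≥ 0`, not necessarily distinct), the zeta polynomial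
`Z_s(X) = ∑_{d ≥ 0} (∑_{a ∈ A∖{0}, deg a = d} a^s) X^d` (which has finitely many nonzero
coefficients) has a zero at `X = 1` of order exactly `2`; i.e. the order of vanishing of the
zeta function of `A` at `−s` is `2`. -/
theorem statement18 (l m n : ℕ) :
    {d : ℕ | zetaCoeff (ZMod 2) (A := A18) (2 ^ l + 2 ^ m + 2 ^ n) d ≠ 0}.Finite ∧
      rootMultiplicity 1 (zetaPoly (ZMod 2) A18 (2 ^ l + 2 ^ m + 2 ^ n)) = 2 := by
  have hB : ((X : (ZMod 2)[X]) ^ 2 + X + 1).natDegree = 2 := by compute_degree!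
  have hD : (((X : (ZMod 2)[X]) ^ 2 + X + 1) * (X ^ 5 + X ^ 2 + 1)).natDegree = 7 := by
    compute_degree!
  replace hB := hB.le.trans (by norm_num : 2 ≤ 3)
  refine ⟨(Finset.finite_toSet _).subset (support_zetaCoeff_subset hB hD l m n), ?_⟩
  have := QuadRing.isDomain hB hD
  have : CharP A18 2 := charP_of_injective_algebraMap (algebraMap (ZMod 2) A18).injective 2
  rw [zetaPoly_eq_sum hB hD l m n]
  refine rootMultiplicity_one_even_sextic _ ?_ ?_
  · rw [← map_sum, sum_powSum, map_zero]
  · rw [← map_add, map_ne_zero_iff _ (QuadRing.of_injective _ _)]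
    exact powSum_one_add_powSum_three_ne_zero (by positivity)
end
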